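/- arXiv:1406.5015 — 10 statements merged into one kernel-verified Lean document; each statement's English description precedes it below -/
import Mathlib

section
/- Lovász Local Lemma (partitioned version). Let (Ω, Pr) be a finite probability space and let 𝒜 = 𝒜₁ ∪ 𝒜₂ ∪ … ∪ 𝒜_r be a partition of a finite set 𝒜 of events such that Pr(A) = p_i for every A ∈ 𝒜_i, i = 1, 2, …, r. Suppose there are real numbers 0 ≤ a₁, a₂, …, a_r < 1 and Δ_{ij} ≥ 0 (i, j = 1, …, r) such that: (i) for every event A ∈ 𝒜_i there exists a set 𝒟_A ⊆ 𝒜 with |𝒟_A ∩ 𝒜_j| ≤ Δ_{ij} for all j = 1, …, r, such that A is mutually independent of the family 𝒜 ∖ (𝒟_A ∪ {A}); and (ii) p_i ≤ a_i ∏_{j=1}^{r} (1 − a_j)^{Δ_{ij}} for all i = 1, …, r. Then Pr(⋂_{A ∈ 𝒜} Aᶜ) > 0. -/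
/-- The probability of the event `E` (a set of outcomes) in the finite probability space
with weight function `w`. -/
noncomputable def Pr {Ω : Type*} (w : Ω → ℝ) (E : Finset Ω) : ℝ := ∑ x ∈ E, w x

/-- The Boolean algebra generated by a family `F` of events: all events obtained from
members of `F` by finitely many unions, intersections and complements. -/
inductive BoolGen {Ω : Type*} [Fintype Ω] [DecidableEq Ω] (F : Set (Finset Ω)) :
    Finset Ω → Prop
  | base {s : Finset Ω} : s ∈ F → BoolGen F s
  | compl {s : Finset Ω} : BoolGen F s → BoolGen F sᶜ
  | union {s t : Finset Ω} : BoolGen F s → BoolGen F t → BoolGen F (s ∪ t)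
  | inter {s t : Finset Ω} : BoolGen F s → BoolGen F t → BoolGen F (s ∩ t)

/-- The event `A` is mutually independent of the family `F` of events:
`Pr (A ∩ B) = Pr A * Pr B` for every `B` in the Boolean algebra generated by `F`. -/
def MutuallyIndep {Ω : Type*} [Fintype Ω] [DecidableEq Ω] (w : Ω → ℝ) (A : Finset Ω)
    (F : Set (Finset Ω)) : Prop :=
  ∀ B : Finset Ω, BoolGen F B → Pr w (A ∩ B) = Pr w A * Pr w B

lemma pr_nonneg {Ω : Type*} (w : Ω → ℝ) (hw0 : ∀ x, 0 ≤ w x) (E : Finset Ω) : 0 ≤ Pr w E :=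
  Finset.sum_nonneg fun x _ => hw0 x

lemma pr_mono {Ω : Type*} (w : Ω → ℝ) (hw0 : ∀ x, 0 ≤ w x) {E F : Finset Ω} (h : E ⊆ F) :
    Pr w E ≤ Pr w F :=
  Finset.sum_le_sum_of_subset_of_nonneg h fun x _ _ => hw0 x

lemma pr_split {Ω : Type*} [Fintype Ω] [DecidableEq Ω] (w : Ω → ℝ) (B N : Finset Ω) :
    Pr w (Bᶜ ∩ N) = Pr w N - Pr w (B ∩ N) := by
  have h : N = (Bᶜ ∩ N) ∪ (B ∩ N) := by
    ext x; simp only [Finset.mem_union, Finset.mem_inter, Finset.mem_compl]; tauto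
  have hd : Disjoint (Bᶜ ∩ N) (B ∩ N) := by
    rw [Finset.disjoint_left]; intro x
    simp only [Finset.mem_inter, Finset.mem_compl]; tauto
  have := Finset.sum_union (f := w) hd
  rw [← h] at this
  unfold Pr
  linarith

lemma boolGen_inf {Ω : Type*} [Fintype Ω] [DecidableEq Ω] (F : Set (Finset Ω))
    (S : Finset (Finset Ω)) (hS : ∀ A ∈ S, A ∈ F) :
    S = ∅ ∨ BoolGen F (S.inf fun A => Aᶜ) := by
  induction S using Finset.induction_on with
  | empty => left; rfl
  | insert B T hB ih =>
    right
    have hb : BoolGen F Bᶜ := .compl (.base (hS B (by simp)))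
    rcases ih (fun A hA => hS A (Finset.mem_insert_of_mem hA)) with h | h
    · subst h; simpa using hb
    · rw [Finset.inf_insert]; exact .inter hb h

lemma lll_core {Ω : Type*} [Fintype Ω] [DecidableEq Ω]
    (w : Ω → ℝ) (hw0 : ∀ x, 0 ≤ w x) (hw1 : ∑ x, w x = 1)
    (U : Finset (Finset Ω)) (x : Finset Ω → ℝ) (hx0 : ∀ A, 0 ≤ x A) (hx1 : ∀ A, x A < 1)
    (h : ∀ A ∈ U, ∃ D : Finset (Finset Ω), Pr w A ≤ x A * ∏ B ∈ D, (1 - x B) ∧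
      MutuallyIndep w A ((U \ insert A D : Finset (Finset Ω)) : Set (Finset Ω)))
    (S : Finset (Finset Ω)) : S ⊆ U →
      0 < Pr w (S.inf fun A => Aᶜ) ∧
      ∀ A ∈ U, A ∉ S → Pr w (A ∩ S.inf fun A => Aᶜ) ≤ x A * Pr w (S.inf fun A => Aᶜ) := by
  induction S using Finset.strongInduction with
  | H S ih =>
  intro hSU
  have step : ∀ T B, B ∈ S → B ∉ T → T ⊆ S →
      0 < Pr w (T.inf fun A => Aᶜ) ∧ (1 - x B) * Pr w (T.inf fun A => Aᶜ) ≤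
        Pr w ((insert B T).inf fun A => Aᶜ) := by
    intro T B hB hBT hT
    have hss : T ⊂ S := (Finset.ssubset_iff_of_subset hT).2 ⟨B, hB, hBT⟩
    obtain ⟨h1, h2⟩ := ih T hss (hT.trans hSU)
    refine ⟨h1, ?_⟩
    have h3 := h2 B (hSU hB) hBT
    rw [Finset.inf_insert, Finset.inf_eq_inter, pr_split]
    linarith
  constructor
  · rcases S.eq_empty_or_nonempty with rfl | ⟨B, hB⟩
    · simp [Pr, hw1]
    · obtain ⟨h1, h2⟩ := step (S.erase B) B hB (by simp) (Finset.erase_subset _ _)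
      rw [Finset.insert_erase hB] at h2
      have := hx1 B
      have : 0 < (1 - x B) * Pr w ((S.erase B).inf fun A => Aᶜ) := mul_pos (by linarith) h1
      linarith
  · intro A hA hAS
    obtain ⟨D, hD, hind⟩ := h A hA
    have claim : ∀ T, T ⊆ S ∩ D →
        (∏ B ∈ T, (1 - x B)) * Pr w ((S \ D).inf fun A => Aᶜ) ≤
          Pr w ((T ∪ (S \ D)).inf fun A => Aᶜ) := by
      intro T
      induction T using Finset.induction_on with
      | empty => simp
      | insert B T hBT ihT =>
        intro hT
        have hB := Finset.mem_inter.1 (hT (Finset.mem_insert_self B T))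
        have hT' : T ⊆ S ∩ D := (Finset.subset_insert _ _).trans hT
        have h1 := ihT hT'
        have h2 := (step (T ∪ (S \ D)) B hB.1 (by simp [hBT, hB.2])
          (Finset.union_subset (hT'.trans Finset.inter_subset_left) Finset.sdiff_subset)).2
        rw [Finset.prod_insert hBT, Finset.insert_union, mul_assoc]
        exact (mul_le_mul_of_nonneg_left h1 (by linarith [hx1 B])).trans h2
    have hc := claim (S ∩ D) subset_rfl
    have hun : S ∩ D ∪ S \ D = S := by
      ext y; simp only [Finset.mem_union, Finset.mem_inter, Finset.mem_sdiff]; tauto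
    rw [hun] at hc
    have hI : Pr w (A ∩ (S \ D).inf fun A => Aᶜ) = Pr w A * Pr w ((S \ D).inf fun A => Aᶜ) := by
      rcases boolGen_inf ((U \ insert A D : Finset (Finset Ω)) : Set (Finset Ω)) (S \ D) (by
        intro B hB
        rw [Finset.mem_sdiff] at hB
        simp only [Finset.mem_coe, Finset.mem_sdiff, Finset.mem_insert, not_or]
        exact ⟨hSU hB.1, fun h => hAS (h ▸ hB.1), hB.2⟩) with he | hb
      · have hu : Pr w (Finset.univ : Finset Ω) = 1 := hw1
        rw [he]; simp [hu]
      · exact hind _ hb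
    have hmono : Pr w (A ∩ S.inf fun A => Aᶜ) ≤ Pr w (A ∩ (S \ D).inf fun A => Aᶜ) :=
      pr_mono w hw0 (Finset.inter_subset_inter subset_rfl (Finset.inf_mono Finset.sdiff_subset))
    have hprod : ∏ B ∈ D, (1 - x B) ≤ ∏ B ∈ S ∩ D, (1 - x B) := by
      rw [← Finset.prod_sdiff (Finset.inter_subset_right : S ∩ D ⊆ D)]
      apply mul_le_of_le_one_left
      · exact Finset.prod_nonneg fun B _ => by linarith [hx1 B]
      · exact Finset.prod_le_one (fun B _ => by linarith [hx1 B]) fun B _ => by linarith [hx0 B]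
    have hn := pr_nonneg w hw0 ((S \ D).inf fun A => Aᶜ)
    calc _ ≤ _ := hmono
      _ = _ := hI
      _ ≤ (x A * ∏ B ∈ D, (1 - x B)) * Pr w ((S \ D).inf fun A => Aᶜ) :=
        mul_le_mul_of_nonneg_right hD hn
      _ = x A * ((∏ B ∈ D, (1 - x B)) * Pr w ((S \ D).inf fun A => Aᶜ)) := by ring
      _ ≤ x A * ((∏ B ∈ S ∩ D, (1 - x B)) * Pr w ((S \ D).inf fun A => Aᶜ)) :=
        mul_le_mul_of_nonneg_left (mul_le_mul_of_nonneg_right hprod hn) (hx0 A)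
      _ ≤ _ := mul_le_mul_of_nonneg_left hc (hx0 A)

/-- **Lovász Local Lemma** (partitioned version). -/
theorem statement_0 {Ω : Type*} [Fintype Ω] [DecidableEq Ω]
    (w : Ω → ℝ) (hw0 : ∀ x, 0 ≤ w x) (hw1 : ∑ x, w x = 1)
    (r : ℕ) (𝒜 : Fin r → Finset (Finset Ω))
    (hdisj : ∀ i j, i ≠ j → Disjoint (𝒜 i) (𝒜 j))
    (p : Fin r → ℝ) (hp : ∀ i, ∀ A ∈ 𝒜 i, Pr w A = p i)
    (a : Fin r → ℝ) (ha0 : ∀ i, 0 ≤ a i) (ha1 : ∀ i, a i < 1)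
    (Δ : Fin r → Fin r → ℝ) (hΔ : ∀ i j, 0 ≤ Δ i j)
    (hind : ∀ i, ∀ A ∈ 𝒜 i, ∃ 𝒟 : Finset (Finset Ω),
      𝒟 ⊆ Finset.univ.biUnion 𝒜 ∧
      (∀ j, ((𝒟 ∩ 𝒜 j).card : ℝ) ≤ Δ i j) ∧
      MutuallyIndep w A (((Finset.univ.biUnion 𝒜 \ insert A 𝒟) : Finset (Finset Ω)) : Set (Finset Ω)))
    (hii : ∀ i, p i ≤ a i * ∏ j, (1 - a j) ^ (Δ i j)) :
    0 < Pr w ((Finset.univ.biUnion 𝒜).inf fun A => Aᶜ) := by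
  classical
  obtain ⟨x, hx0, hx1, hxa⟩ : ∃ x : Finset Ω → ℝ, (∀ A, 0 ≤ x A) ∧ (∀ A, x A < 1) ∧
      ∀ i, ∀ A ∈ 𝒜 i, x A = a i := by
    refine ⟨fun A => if h : ∃ i, A ∈ 𝒜 i then a h.choose else 0, ?_, ?_, ?_⟩
    · intro A; dsimp only; split_ifs
      · exact ha0 _
      · exact le_rfl
    · intro A; dsimp only; split_ifs
      · exact ha1 _
      · exact one_pos
    · intro i A hA
      have h : ∃ i, A ∈ 𝒜 i := ⟨i, hA⟩
      dsimp only
      rw [dif_pos h]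
      by_contra hne
      have hij : h.choose ≠ i := fun e => hne (by rw [e])
      exact Finset.disjoint_left.1 (hdisj _ _ hij) h.choose_spec hA
  refine (lll_core w hw0 hw1 (Finset.univ.biUnion 𝒜) x hx0 hx1 ?_ _ subset_rfl).1
  intro A hA
  obtain ⟨i, -, hAi⟩ := Finset.mem_biUnion.1 hA
  obtain ⟨D, hDU, hcard, hI⟩ := hind i A hAi
  refine ⟨D, ?_, hI⟩
  rw [hp i A hAi, hxa i A hAi]
  refine (hii i).trans (mul_le_mul_of_nonneg_left ?_ (ha0 i))
  have hDe : D = Finset.univ.biUnion fun j => D ∩ 𝒜 j := by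
    rw [← Finset.inter_biUnion]
    exact (Finset.inter_eq_left.2 hDU).symm
  have hprod : ∏ B ∈ D, (1 - x B) = ∏ j, ∏ B ∈ D ∩ 𝒜 j, (1 - x B) := by
    conv_lhs => rw [hDe]
    apply Finset.prod_biUnion
    intro j _ k _ hjk
    exact (hdisj j k hjk).mono Finset.inter_subset_right Finset.inter_subset_right
  rw [hprod]
  apply Finset.prod_le_prod
  · intro j _; exact Real.rpow_nonneg (by linarith [ha1 j]) _
  · intro j _
    have : ∏ B ∈ D ∩ 𝒜 j, (1 - x B) = (1 - a j) ^ (D ∩ 𝒜 j).card := by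
      apply Finset.prod_eq_pow_card
      intro B hB
      rw [hxa j B (Finset.mem_inter.1 hB).2]
    rw [this, ← Real.rpow_natCast]
    exact Real.rpow_le_rpow_of_exponent_ge (by linarith [ha1 j]) (by linarith [ha0 j]) (hcard j)
end

section
/- Let Θ = (Θ_n)_{n∈ℕ} be a sequence of pairwise disjoint finite connected graphs with all vertex degrees at most D (D ≥ 3 an integer), with girth(Θ_n) → ∞, girth(Θ_n) < girth(Θ_{n+1}), and diam(Θ_n) ≤ A·girth(Θ_n) for a universal constant A > 0, and let λ ∈ (0, 1/6] satisfy λ·girth(Θ_n) > 1 for every n. Set L = ⌈2De⁴·D^{2A/λ+1}⌉ (e the Euler constant). Then there exists a sequence of labellings (l_n)_{n∈ℕ} of the graphs (Θ_n)_{n∈ℕ} over a common symmetrized set of L labels such that, for every n, no l_n-labeling of a path of length at least λ·girth(Θ_n) in Θ_n appears as the l_{n'}-labeling of a path in Θ_{n'} for any n' ≠ n. -/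
/-- A walk of length `n` without backtracking (a "path" in the sense of the paper),
encoded by the function of its consecutive vertices. -/
def IsNBPath {V : Type*} (G : SimpleGraph V) (n : ℕ) (f : ℕ → V) : Prop :=
  (∀ i, i < n → G.Adj (f i) (f (i + 1))) ∧ (∀ i, i + 2 ≤ n → f i ≠ f (i + 2))

/-- `ℓ` is a labeling of `G` over a symmetrized alphabet with involution `bar`:
the two orientations of each edge receive mutually inverse labels. -/
def IsLabeling {V Λ : Type*} (G : SimpleGraph V) (bar : Λ → Λ) (ℓ : V → V → Λ) : Prop :=
  ∀ u v, G.Adj u v → ℓ v u = bar (ℓ u v)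

open Finset in
theorem rosen {E I Λ : Type*} [Fintype E] [DecidableEq E] [Fintype I] [Fintype Λ] [Nonempty Λ]
    (s : I → Finset E) (a : I → E → Λ) (β : ℝ) (hβ : 0 < β)
    (h : ∀ e, ∑ i with e ∈ s i, β * (β ^ (s i).card)⁻¹ ≤ Fintype.card Λ - β) :
    ∃ c : E → Λ, ∀ i, (s i).Nonempty → ∃ e ∈ s i, c e ≠ a i e := by
  classical
  let Good : Finset E → Finset (E → Λ) := fun S =>
    {c | ∀ i, (s i).Nonempty → s i ⊆ S → ∃ e ∈ s i, c e ≠ a i e}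
  have hGood : ∀ S c, c ∈ Good S ↔ ∀ i, (s i).Nonempty → s i ⊆ S → ∃ e ∈ s i, c e ≠ a i e := by
    intro S c; simp [Good]
  set L : ℝ := (Fintype.card Λ : ℝ) with hLdef
  have hL : 0 < L := by
    rw [hLdef]; exact_mod_cast Fintype.card_pos
  -- chain
  have chain : ∀ n, (∀ T : Finset E, T.card < n → ∀ e ∉ T,
      β * (Good T).card ≤ L * (Good (insert e T)).card) →
      ∀ U T : Finset E, Disjoint U T → (U ∪ T).card ≤ n →
      β ^ U.card * (Good T).card ≤ L ^ U.card * (Good (U ∪ T)).card := by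
    intro n hn U
    induction U using Finset.induction_on with
    | empty => intro T _ _; simp
    | insert e U he ih =>
      intro T hd hc
      rw [Finset.disjoint_insert_left] at hd
      have heU : e ∉ U ∪ T := by simp [he, hd.1]
      rw [Finset.insert_union, Finset.card_insert_of_notMem heU] at hc
      have h1 := ih T hd.2 (by omega)
      have h2 := hn (U ∪ T) (by omega) e heU
      rw [Finset.card_insert_of_notMem he, Finset.insert_union, pow_succ, pow_succ]
      calc β ^ U.card * β * (Good T).card = β * (β ^ U.card * (Good T).card) := by ring
        _ ≤ β * (L ^ U.card * (Good (U ∪ T)).card) := by gcongr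
        _ = L ^ U.card * (β * (Good (U ∪ T)).card) := by ring
        _ ≤ L ^ U.card * (L * (Good (insert e (U ∪ T))).card) := by gcongr
        _ = _ := by ring
  have bad : ∀ (S : Finset E) (i : I),
      L ^ (s i).card * ((Good S).filter (fun c => ∀ e ∈ s i, c e = a i e)).card
        ≤ (Good (S \ s i)).card := by
    intro S i
    have : Fintype.card (s i → Λ) * ((Good S).filter (fun c => ∀ e ∈ s i, c e = a i e)).card
        ≤ (Good (S \ s i)).card := by
      rw [← Finset.card_univ, ← Finset.card_product]
      apply Finset.card_le_card_of_injOn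
        (fun wc e => if h : e ∈ s i then wc.1 ⟨e, h⟩ else wc.2 e)
      · rintro ⟨w, c⟩ hwc
        simp only [Finset.coe_product, Set.mem_prod, Finset.mem_coe, Finset.mem_filter] at hwc
        simp only [Finset.mem_coe]
        rw [hGood]
        intro i' hne hsub
        obtain ⟨e, he, hce⟩ := (hGood _ _).1 hwc.2.1 i' hne (hsub.trans Finset.sdiff_subset)
        refine ⟨e, he, ?_⟩
        have := hsub he
        rw [Finset.mem_sdiff] at this
        simpa [this.2] using hce
      · rintro ⟨w, c⟩ hwc ⟨w', c'⟩ hwc' heq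
        simp only [Finset.coe_product, Set.mem_prod, Finset.mem_coe, Finset.mem_filter] at hwc hwc'
        have h1 : ∀ e, _ := fun e => congrFun heq e
        simp only at h1
        refine Prod.ext ?_ ?_
        · funext ⟨e, he⟩
          have := h1 e
          simpa [he] using this
        · funext e
          by_cases he : e ∈ s i
          · exact (hwc.2.2 e he).trans (hwc'.2.2 e he).symm
          · have := h1 e
            simpa [he] using this
    have h2 : (Fintype.card (s i → Λ) : ℝ) = L ^ (s i).card := by
      rw [Fintype.card_fun, Fintype.card_coe]; push_cast; rfl
    rw [← h2]; exact_mod_cast this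
  have main : ∀ n, ∀ T : Finset E, T.card < n → ∀ e ∉ T,
      β * (Good T).card ≤ L * (Good (insert e T)).card := by
    intro n
    induction n with
    | zero => intro T hT; omega
    | succ n ih =>
      intro S hS e he
      have hsub : Good S ⊆ Good (insert e S) ∪ (univ.filter (fun i => e ∈ s i)).biUnion
          (fun i => if s i ⊆ insert e S then
            (Good S).filter (fun c => ∀ e ∈ s i, c e = a i e) else ∅) := by
        intro c hc
        by_cases hc' : c ∈ Good (insert e S)
        · exact Finset.mem_union_left _ hc'
        · apply Finset.mem_union_right
          rw [hGood] at hc'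
          push Not at hc'
          obtain ⟨i, hne, hs, hall⟩ := hc'
          have hei : e ∈ s i := by
            by_contra hei
            obtain ⟨e', he', hh⟩ := (hGood _ _).1 hc i hne ((Finset.subset_insert_iff_of_notMem hei).1 hs)
            exact hh (hall e' he')
          rw [Finset.mem_biUnion]
          refine ⟨i, by simp [hei], ?_⟩
          rw [if_pos hs, Finset.mem_filter]
          exact ⟨hc, hall⟩
      have hcard := (Finset.card_le_card hsub).trans ((Finset.card_union_le _ _).trans
        (Nat.add_le_add_left Finset.card_biUnion_le _))
      have hterm : ∀ i ∈ univ.filter (fun i => e ∈ s i), L * (((if s i ⊆ insert e S then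
            (Good S).filter (fun c => ∀ e ∈ s i, c e = a i e) else ∅ : Finset (E → Λ)).card : ℕ) : ℝ)
            ≤ (β * (β ^ (s i).card)⁻¹) * (Good S).card := by
        intro i hi
        rw [Finset.mem_filter] at hi
        split_ifs with hs
        · have hb := bad S i
          have hun : (s i ∩ S) ∪ (S \ s i) = S := by
            ext x; simp only [mem_union, mem_inter, mem_sdiff]; tauto
          have hc := chain n ih (s i ∩ S) (S \ s i)
            (by rw [Finset.disjoint_left]; intro x; simp only [mem_inter, mem_sdiff]; tauto)
            (by rw [hun]; omega)
          rw [hun] at hc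
          have hk : (s i).card = (s i ∩ S).card + 1 := by
            have : s i = insert e (s i ∩ S) := by
              ext x
              simp only [mem_insert, mem_inter]
              constructor
              · intro hx
                have := hs hx
                simp only [mem_insert] at this
                tauto
              · rintro (rfl | hx)
                · exact hi.2
                · exact hx.1
            conv_lhs => rw [this]
            rw [Finset.card_insert_of_notMem]
            simp [he]
          rw [hk] at hb ⊢
          set m := (s i ∩ S).card
          set B : ℝ := (((Good S).filter (fun c => ∀ e ∈ s i, c e = a i e)).card : ℝ)
          have hβm : 0 < β ^ m := by positivity
          have hLm : 0 < L ^ m := by positivity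
          have e1 : β * (β ^ (m + 1))⁻¹ = (β ^ m)⁻¹ := by
            rw [pow_succ]; field_simp
          rw [e1, inv_mul_eq_div, le_div_iff₀ hβm]
          have : L ^ m * (L * B * β ^ m) ≤ L ^ m * (Good S).card := by
            calc L ^ m * (L * B * β ^ m) = β ^ m * (L ^ (m+1) * B) := by ring
              _ ≤ β ^ m * (Good (S \ s i)).card := by gcongr
              _ ≤ _ := hc
          exact le_of_mul_le_mul_left this hLm
        · simp; positivity
      have hsum := Finset.sum_le_sum hterm
      rw [← Finset.mul_sum, ← Finset.sum_mul] at hsum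
      have he' := h e
      have hG : (0:ℝ) ≤ (Good S).card := by positivity
      have h3 := hsum.trans (mul_le_mul_of_nonneg_right he' hG)
      have h4 : ((Good S).card : ℝ) ≤ (Good (insert e S)).card +
        ∑ i with e ∈ s i, (((if s i ⊆ insert e S then
            (Good S).filter (fun c => ∀ e ∈ s i, c e = a i e) else ∅ : Finset (E → Λ)).card : ℕ) : ℝ) := by
        exact_mod_cast hcard
      have h5 := mul_le_mul_of_nonneg_left h4 hL.le
      rw [mul_add] at h5
      linarith
  have fin := chain (Fintype.card E) (main _) univ ∅ (by simp) (by simp)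
  have h0 : Good ∅ = univ := by
    ext c
    rw [hGood]
    simp only [Finset.subset_empty, mem_univ, iff_true]
    intro i hne h0
    simp [h0] at hne
  rw [h0] at fin
  have hp : (0 : ℝ) < β ^ (univ : Finset E).card * (univ : Finset (E → Λ)).card := by
    have : 0 < (univ : Finset (E → Λ)).card := by
      rw [Finset.card_univ]; exact Fintype.card_pos
    positivity
  have hp2 := hp.trans_le fin
  have hp3 : (Good (univ ∪ ∅)).Nonempty := by
    rw [← Finset.card_pos]
    by_contra hcon
    have : (Good (univ ∪ ∅)).card = 0 := by omega
    rw [this] at hp2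
    simp at hp2
  obtain ⟨c, hc⟩ := hp3
  exact ⟨c, fun i hi => (hGood _ _).1 hc i hi (by simp)⟩

def IsW {V : Type*} (G : SimpleGraph V) {k : ℕ} (p : Fin (k+1) → V) : Prop :=
  ∀ i : Fin k, G.Adj (p i.castSucc) (p i.succ)

open Classical in
theorem count_walk {V : Type*} [Fintype V] (G : SimpleGraph V) [DecidableRel G.Adj] (D : ℕ)
    (hD : 3 ≤ D)
    (hdeg : ∀ v, G.degree v ≤ D) (k : ℕ) (j : Fin (k+1)) (u : V) :
    (Finset.univ.filter (fun p : Fin (k+1) → V => IsW G p ∧ p j = u)).card ≤ D ^ k := by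
  have hcode : ∀ v, ∃ c : V → Fin D, ∀ x y, G.Adj v x → G.Adj v y → c x = c y → x = y := by
    intro v
    have hn : Nonempty (G.neighborFinset v ↪ Fin D) := by
      apply Function.Embedding.nonempty_of_card_le
      rw [Fintype.card_coe, Fintype.card_fin]
      simpa using hdeg v
    obtain ⟨φ⟩ := hn
    refine ⟨fun x => if h : x ∈ G.neighborFinset v then φ ⟨x, h⟩ else ⟨0, by omega⟩, ?_⟩
    intro x y hx hy
    simp only [SimpleGraph.mem_neighborFinset, hx, hy, dif_pos]
    intro h
    simpa using φ.injective h
  choose code hcode using hcode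
  have : D ^ k = (Finset.univ : Finset (Fin k → Fin D)).card := by simp
  rw [this]
  apply Finset.card_le_card_of_injOn (fun p i => if j.1 ≤ i.1 then code (p i.castSucc) (p i.succ)
    else code (p i.succ) (p i.castSucc))
  · intro _ _; simp
  · intro p hp q hq heq
    simp only [Finset.coe_filter, Finset.mem_univ, true_and, Set.mem_ofPred_eq] at hp hq
    obtain ⟨hp, hpj⟩ := hp
    obtain ⟨hq, hqj⟩ := hq
    have heq' := fun i => congrFun heq i
    simp only at heq'
    have up : ∀ i, j.1 ≤ i → ∀ (hi : i < k + 1), p ⟨i, hi⟩ = q ⟨i, hi⟩ := by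
      intro i hij
      induction i, hij using Nat.le_induction with
      | base => intro hi; exact hpj.trans hqj.symm
      | succ i hij ih =>
        intro hi
        have h1 := ih (by omega)
        have h2 := heq' ⟨i, by omega⟩
        have a1 := hp ⟨i, by omega⟩
        have a2 := hq ⟨i, by omega⟩
        simp only [Fin.castSucc_mk, Fin.succ_mk] at h2 a1 a2
        simp only [hij, if_true, ] at h2
        rw [← h1] at h2 a2
        exact hcode _ _ _ a1 a2 h2
    have down : ∀ d, d ≤ j.1 → ∀ (hi : j.1 - d < k + 1), p ⟨j.1 - d, hi⟩ = q ⟨j.1 - d, hi⟩ := by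
      intro d
      induction d with
      | zero => intro _ hi; exact hpj.trans hqj.symm
      | succ d ih =>
        intro hd hi
        have hj := j.2
        have h1 := ih (by omega) (by omega)
        obtain ⟨t, ht⟩ : ∃ t, t = j.1 - (d+1) := ⟨_, rfl⟩
        have ht' : j.1 - d = t + 1 := by omega
        simp only [ht', ← ht] at h1 ⊢
        have h2 := heq' ⟨t, by omega⟩
        have a1 := hp ⟨t, by omega⟩
        have a2 := hq ⟨t, by omega⟩
        have hjt : ¬ j.1 ≤ t := by omega
        simp only [Fin.castSucc_mk, Fin.succ_mk] at h2 a1 a2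
        simp only [hjt, if_false] at h2
        rw [← h1] at h2 a2
        exact hcode _ _ _ a1.symm a2.symm h2
    funext i
    rcases le_total j.1 i.1 with h | h
    · exact up i.1 h i.2
    · have := down (j.1 - i.1) (by omega) (by omega)
      have e : j.1 - (j.1 - i.1) = i.1 := by omega
      simpa [e] using this

theorem card_le_diam {V : Type*} [Fintype V] (G : SimpleGraph V) [DecidableRel G.Adj] (D : ℕ)
    (hD : 3 ≤ D) (hdeg : ∀ v, G.degree v ≤ D) (hc : G.Connected) :
    Fintype.card V ≤ 2 * D ^ G.diam := by
  classical
  have := hc.nonempty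
  obtain ⟨v0⟩ := hc.nonempty
  let S : ℕ → Finset V := fun r => Nat.rec {v0} (fun _ s => s.biUnion (fun v => G.neighborFinset v)) r
  have hS1 : ∀ r, S (r+1) = (S r).biUnion (fun v => G.neighborFinset v) := fun r => rfl
  have hcard : ∀ r, (S r).card ≤ D ^ r := by
    intro r
    induction r with
    | zero => simp [S]
    | succ r ih =>
      rw [hS1, pow_succ]
      refine (Finset.card_biUnion_le_card_mul _ _ D ?_).trans (Nat.mul_le_mul_right _ ih)
      intro v _
      simpa using hdeg v
  have hmem : ∀ (u v : V) (p : G.Walk u v) (r : ℕ), u ∈ S r → v ∈ S (r + p.length) := by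
    intro u v p
    induction p with
    | nil => intro r h; simpa using h
    | cons h p ih =>
      intro r hu
      have := ih (r+1) (by rw [hS1, Finset.mem_biUnion]; exact ⟨_, hu, by simpa using h⟩)
      rw [SimpleGraph.Walk.length_cons]
      convert this using 2
      omega
  have hsub : (Finset.univ : Finset V) ⊆ (Finset.range (G.diam + 1)).biUnion S := by
    intro v _
    obtain ⟨p, hp⟩ := hc.exists_walk_length_eq_dist v0 v
    rw [Finset.mem_biUnion]
    refine ⟨G.dist v0 v, ?_, ?_⟩
    · have := SimpleGraph.dist_le_diam (SimpleGraph.connected_iff_ediam_ne_top.1 hc) (u := v0) (v := v)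
      simp; omega
    · have := hmem v0 v p 0 (by simp [S])
      simpa [hp] using this
  have h1 := (Finset.card_le_card hsub).trans Finset.card_biUnion_le
  have h2 : ∀ m, ∑ r ∈ Finset.range (m+1), D ^ r ≤ 2 * D ^ m := by
    intro m
    induction m with
    | zero => simp
    | succ m ih =>
      rw [Finset.sum_range_succ, pow_succ]
      have : 0 < D ^ m := by positivity
      nlinarith
  rw [Finset.card_univ] at h1
  exact h1.trans ((Finset.sum_le_sum (fun r _ => hcard r)).trans (h2 _))

theorem girth_le_card {V : Type*} [Fintype V] (G : SimpleGraph V) (h : 0 < G.girth) :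
    G.girth ≤ Fintype.card V := by
  have hA : ¬ G.IsAcyclic := by rw [← SimpleGraph.girth_eq_zero]; omega
  obtain ⟨a, w, hw, hl⟩ := SimpleGraph.exists_girth_eq_length.2 hA
  rw [hl]
  have h1 := hw.support_nodup.length_le_card
  simpa using h1

theorem mkWalk {V : Type*} (G : SimpleGraph V) (f : ℕ → V) (m : ℕ) : ∀ (a : ℕ)
    (_ : ∀ i, a ≤ i → i < a + m → G.Adj (f i) (f (i+1))),
    ∃ p : G.Walk (f a) (f (a+m)), p.length = m ∧
      p.support = (List.range' a (m+1)).map f ∧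
      p.edges = (List.range' a m).map (fun t => s(f t, f (t+1))) := by
  induction m with
  | zero => intro a _; exact ⟨SimpleGraph.Walk.nil, by simp, by simp, by simp⟩
  | succ m ih =>
    intro a h
    obtain ⟨p, h1, h2, h3⟩ := ih (a+1) (fun i hi hi' => h i (by omega) (by omega))
    refine ⟨(SimpleGraph.Walk.cons (h a le_rfl (by omega)) p).copy rfl (by congr 1; omega), ?_, ?_, ?_⟩
    · simp [h1]
    · rw [SimpleGraph.Walk.support_copy, SimpleGraph.Walk.support_cons, h2]
      simp [List.range'_succ]
    · rw [SimpleGraph.Walk.edges_copy, SimpleGraph.Walk.edges_cons, h3]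
      simp [List.range'_succ]

theorem nb_inj {V : Type*} (G : SimpleGraph V) (k : ℕ) (f : ℕ → V) (hk : k < G.girth)
    (h : IsNBPath G k f) : ∀ d i, 0 < d → i + d ≤ k → f i ≠ f (i + d) := by
  intro d
  induction d using Nat.strong_induction_on with
  | _ d ih =>
  intro i hd hi heq
  have hd1 : d ≠ 1 := by
    rintro rfl
    exact (h.1 i (by omega)).ne heq
  have hd2 : d ≠ 2 := by
    rintro rfl
    exact h.2 i hi heq
  -- injectivity on `[i, i+d)` and on `(i, i+d]`
  have inj : ∀ x y, i ≤ x → x < y → y ≤ i + d → y < x + d → f x ≠ f y := by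
    intro x y hx hxy hy hyx
    have := ih (y - x) (by omega) x (by omega) (by omega)
    rwa [Nat.add_sub_cancel' hxy.le] at this
  obtain ⟨m, rfl⟩ : ∃ m, d = m + 1 := ⟨d - 1, by omega⟩
  obtain ⟨p, h1, h2, h3⟩ := mkWalk G f m (i+1) (fun t _ ht => h.1 t (by omega))
  have he : f (i + 1 + m) = f i := by rw [heq]; congr 1; omega
  have hpath : p.IsPath := by
    rw [SimpleGraph.Walk.isPath_def, h2]
    apply List.Nodup.map_on _ List.nodup_range'
    intro x hx y hy hxy
    rw [List.mem_range'_1] at hx hy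
    by_contra hne
    rcases Nat.lt_or_gt_of_ne hne with hlt | hlt
    · exact inj x y (by omega) hlt (by omega) (by omega) hxy
    · exact inj y x (by omega) hlt (by omega) (by omega) hxy.symm
  have hcyc : (SimpleGraph.Walk.cons (h.1 i (by omega)) (p.copy rfl he)).IsCycle := by
    rw [SimpleGraph.Walk.cons_isCycle_iff]
    refine ⟨by simpa using hpath, ?_⟩
    rw [SimpleGraph.Walk.edges_copy, h3, List.mem_map]
    rintro ⟨t, ht, hte⟩
    rw [List.mem_range'_1] at ht
    rw [Sym2.eq_iff] at hte
    rcases hte with ⟨ha, hb⟩ | ⟨ha, hb⟩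
    · exact inj i t le_rfl (by omega) (by omega) (by omega) ha.symm
    · rcases Nat.lt_or_ge (t + 1) (i + (m + 1)) with hlt | hge
      · exact inj i (t+1) le_rfl (by omega) (by omega) (by omega) hb.symm
      · exact inj (i+1) t (by omega) (by omega) (by omega) (by omega) ha.symm
  have := SimpleGraph.girth_le_length hcyc
  simp [h1] at this
  omega

theorem term_bound (D : ℕ) (hD : 3 ≤ D) (A lam : ℝ) (hA : 0 < A) (hlam0 : 0 < lam)
    (g d N k : ℕ) (hN : N ≤ 2 * D ^ d) (hg : g ≤ N) (hd : (d : ℝ) ≤ A * g)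
    (hlg : 1 < lam * g) (hk : k = ⌈lam * (g : ℝ)⌉₊) (β : ℝ)
    (hβ : (D : ℝ) ^ (2 * A / lam + 2) * Real.exp 1 ^ 4 ≤ β) :
    (2 * k * (D : ℝ) ^ k) * (N * (D : ℝ) ^ k) * (β ^ k)⁻¹ ≤ 16 * lam * Real.exp (-(4 * lam * g)) := by
  have hD0 : (0 : ℝ) < D := by positivity
  have hD1 : (1 : ℝ) ≤ D := by exact_mod_cast (by omega : 1 ≤ D)
  have hk1 : lam * g ≤ k := by rw [hk]; exact Nat.le_ceil _
  have hk2 : (k : ℝ) < lam * g + 1 := by rw [hk]; exact Nat.ceil_lt_add_one (by linarith)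
  have hNr : (N : ℝ) ≤ 2 * (D : ℝ) ^ d := by exact_mod_cast hN
  have hgr : (g : ℝ) ≤ N := by exact_mod_cast hg
  have hB0 : 0 < (D : ℝ) ^ (2 * A / lam + 2) * Real.exp 1 ^ 4 := by positivity
  have hβ0 : 0 < β := hB0.trans_le hβ
  have h1 : ((D : ℝ) ^ (2 * A / lam + 2) * Real.exp 1 ^ 4) ^ k ≤ β ^ k := by gcongr
  have h2 : ((D : ℝ) ^ (2 * A / lam + 2) * Real.exp 1 ^ 4) ^ k
      = (D : ℝ) ^ (2 * A / lam * k) * (D : ℝ) ^ (2 * k) * Real.exp (4 * k) := by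
    rw [mul_pow, ← Real.rpow_mul_natCast hD0.le, add_mul, Real.rpow_add hD0]
    congr 1
    · congr 1
      rw [← Real.rpow_natCast]; push_cast; rfl
    · rw [← pow_mul, ← Real.exp_nat_mul]; push_cast; ring_nf
  have h3 : ((D : ℝ) ^ d) ^ 2 ≤ (D : ℝ) ^ (2 * A / lam * k) := by
    rw [← pow_mul, ← Real.rpow_natCast]
    apply Real.rpow_le_rpow_of_exponent_le hD1
    push_cast
    rw [div_mul_eq_mul_div, le_div_iff₀ hlam0]
    nlinarith
  have h4 : (N : ℝ) ^ 2 / 4 ≤ ((D : ℝ) ^ d) ^ 2 := by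
    have : (0 : ℝ) ≤ N := by positivity
    nlinarith
  have h5 : (N : ℝ) ^ 2 / 4 * (D : ℝ) ^ (2 * k) * Real.exp (4 * k) ≤ β ^ k := by
    refine le_trans ?_ (h2 ▸ h1)
    gcongr
    exact h4.trans h3
  have h6 : 1 ≤ Real.exp (-(4 * lam * g)) * Real.exp (4 * k) := by
    rw [← Real.exp_add]
    apply Real.one_le_exp
    linarith
  rw [← div_eq_mul_inv, div_le_iff₀ (by positivity)]
  have hk3 : (k : ℝ) ≤ 2 * lam * N := by nlinarith
  calc (2 * k * (D : ℝ) ^ k) * (N * (D : ℝ) ^ k) = k * (2 * N * (D : ℝ) ^ (2 * k)) := by ring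
    _ ≤ (2 * lam * N) * (2 * N * (D : ℝ) ^ (2 * k)) := by gcongr
    _ = (4 * lam * N ^ 2 * (D : ℝ) ^ (2 * k)) * 1 := by ring
    _ ≤ (4 * lam * N ^ 2 * (D : ℝ) ^ (2 * k)) * (Real.exp (-(4 * lam * g)) * Real.exp (4 * k)) := by
      gcongr
    _ = 16 * lam * Real.exp (-(4 * lam * g)) * ((N : ℝ) ^ 2 / 4 * (D : ℝ) ^ (2 * k) * Real.exp (4 * k)) := by
      ring
    _ ≤ _ := by gcongr

theorem sum_bound (lam : ℝ) (hlam0 : 0 < lam) (hlam6 : lam ≤ 1 / 6) (g : ℕ → ℕ)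
    (hmono : ∀ n, g n < g (n+1)) (h0 : 1 < lam * g 0) (m : ℕ) :
    ∑ n ∈ Finset.range m, 16 * lam * Real.exp (-(4 * lam * g n)) ≤ 1 := by
  have hg : ∀ n, g 0 + n ≤ g n := by
    intro n
    induction n with
    | zero => simp
    | succ n ih => have := hmono n; omega
  set x := Real.exp (-(4 * lam)) with hx
  have hx0 : 0 < x := Real.exp_pos _
  have hxle : x * (1 + 4 * lam) ≤ 1 := by
    have h1 := Real.add_one_le_exp (4 * lam)
    have h2 : x * Real.exp (4 * lam) = 1 := by rw [hx, ← Real.exp_add]; simp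
    nlinarith
  have hx1 : x < 1 := by nlinarith
  have he : Real.exp (-4) ≤ 1 / 16 := by
    have h1 : (16 : ℝ) ≤ Real.exp 4 := by
      have := Real.add_one_le_exp (1 : ℝ)
      have h4 : Real.exp 4 = Real.exp 1 ^ 4 := by rw [← Real.exp_nat_mul]; norm_num
      rw [h4]
      calc (16 : ℝ) = 2 ^ 4 := by norm_num
        _ ≤ _ := by gcongr; linarith
    rw [Real.exp_neg, one_div]
    exact inv_anti₀ (by norm_num) h1
  have ht : ∀ n ∈ Finset.range m, 16 * lam * Real.exp (-(4 * lam * g n)) ≤ lam * x ^ n := by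
    intro n _
    have h1 : Real.exp (-(4 * lam * g n)) ≤ Real.exp (-4) * x ^ n := by
      rw [hx, ← Real.exp_nat_mul, ← Real.exp_add]
      apply Real.exp_le_exp.2
      have : (g 0 : ℝ) + n ≤ g n := by exact_mod_cast hg n
      nlinarith
    have hxn : 0 ≤ x ^ n := by positivity
    calc 16 * lam * Real.exp (-(4 * lam * g n)) ≤ 16 * lam * (Real.exp (-4) * x ^ n) := by gcongr
      _ ≤ 16 * lam * (1 / 16 * x ^ n) := by gcongr
      _ = _ := by ring
  refine (Finset.sum_le_sum ht).trans ?_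
  rw [← Finset.mul_sum]
  have hs : ∑ n ∈ Finset.range m, x ^ n ≤ (1 - x)⁻¹ := by
    rw [← tsum_geometric_of_lt_one hx0.le hx1]
    exact (summable_geometric_of_lt_one hx0.le hx1).sum_le_tsum _ (fun _ _ => by positivity)
  refine (mul_le_mul_of_nonneg_left hs hlam0.le).trans ?_
  rw [← div_eq_mul_inv, div_le_one (by linarith)]
  nlinarith

theorem edge_inj {V : Type*} {k : ℕ} (p : Fin (k+1) → V) (hp : Function.Injective p) :
    Function.Injective (fun i : Fin k => s(p i.castSucc, p i.succ)) := by
  intro i j h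
  simp only [Sym2.eq_iff, hp.eq_iff, Fin.ext_iff, Fin.val_castSucc, Fin.val_succ] at h
  ext
  omega

open Classical in
theorem step (D : ℕ) (hD : 3 ≤ D) {Λ : Type} [Fintype Λ] [Nonempty Λ]
    (V : ℕ → Type) [∀ n, Fintype (V n)]
    (G : ∀ n, SimpleGraph (V n)) [∀ n, DecidableRel (G n).Adj]
    (hdeg : ∀ n, ∀ v : V n, (G n).degree v ≤ D) (m : ℕ) (k : ℕ → ℕ)
    (hk0 : ∀ n < m, 0 < k n) (hk : ∀ n < m, k n < (G m).girth) (β : ℝ) (hβ : 0 < β)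
    (hsum : ∑ n ∈ Finset.range m, (2 * (k n : ℝ) * (D : ℝ) ^ k n) *
      (Fintype.card (V n) * (D : ℝ) ^ k n) * (β ^ k n)⁻¹ ≤ 1)
    (hβL : 2 * β ≤ Fintype.card Λ) (l : ∀ n, V n → V n → Λ) :
    ∃ c : V m → V m → Λ, (∀ u v, c v u = c u v) ∧
      ∀ n < m, ∀ (f : ℕ → V n) (g : ℕ → V m), IsNBPath (G n) (k n) f → IsNBPath (G m) (k n) g →
        ¬ ∀ i < k n, l n (f i) (f (i+1)) = c (g i) (g (i+1)) := by
  let I := Σ n : Fin m, {p : Fin (k n + 1) → V m // IsW (G m) p ∧ Function.Injective p} ×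
    {q : Fin (k n + 1) → V n // IsW (G n) q}
  let edge : ∀ {k : ℕ}, (Fin (k+1) → V m) → Fin k → Sym2 (V m) :=
    fun p i => s(p i.castSucc, p i.succ)
  let s : I → Finset (Sym2 (V m)) := fun x => Finset.univ.image (edge x.2.1.1)
  let a : I → Sym2 (V m) → Λ := fun x => Function.extend (edge x.2.1.1)
    (fun i => l x.1 (x.2.2.1 i.castSucc) (x.2.2.1 i.succ)) (fun _ => Classical.arbitrary Λ)
  have hs : ∀ x : I, (s x).card = k x.1 := by
    intro x
    rw [Finset.card_image_of_injective _ (edge_inj _ x.2.1.2.2)]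
    simp
  have hq : ∀ n, Fintype.card {q : Fin (k n + 1) → V n // IsW (G n) q} ≤
      Fintype.card (V n) * D ^ k n := by
    intro n
    rw [Fintype.card_subtype]
    have hsub : (Finset.univ.filter (fun q : Fin (k n + 1) → V n => IsW (G n) q)) ⊆
        (Finset.univ : Finset (V n)).biUnion
          (fun u => Finset.univ.filter (fun q : Fin (k n + 1) → V n => IsW (G n) q ∧ q 0 = u)) := by
      intro q hq
      simpa using hq
    refine (Finset.card_le_card hsub).trans ?_
    refine (Finset.card_biUnion_le_card_mul _ _ (D ^ k n) ?_).trans (by simp)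
    intro u _
    exact count_walk (G n) D hD (hdeg n) _ _ _
  have hp : ∀ (e : Sym2 (V m)) (k : ℕ), (Finset.univ.filter
      (fun p : {p : Fin (k + 1) → V m // IsW (G m) p ∧ Function.Injective p} =>
        e ∈ Finset.univ.image (edge p.1))).card ≤ 2 * k * D ^ k := by
    intro e k
    induction e using Sym2.ind with
    | _ u v =>
    rw [← Finset.card_map (Function.Embedding.subtype _)]
    have hsub : (Finset.univ.filter
      (fun p : {p : Fin (k + 1) → V m // IsW (G m) p ∧ Function.Injective p} =>
        s(u, v) ∈ Finset.univ.image (edge p.1))).map (Function.Embedding.subtype _) ⊆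
        (Finset.univ : Finset (Fin k)).biUnion (fun j =>
          Finset.univ.filter (fun q : Fin (k + 1) → V m => IsW (G m) q ∧ q j.castSucc = u) ∪
          Finset.univ.filter (fun q : Fin (k + 1) → V m => IsW (G m) q ∧ q j.castSucc = v)) := by
      intro q hq
      simp only [Finset.mem_map, Finset.mem_filter, Finset.mem_univ, true_and, Finset.mem_image,
        Function.Embedding.subtype_apply] at hq
      obtain ⟨⟨q', hW, hI⟩, ⟨j, hj⟩, rfl⟩ := hq
      simp only [Finset.mem_biUnion, Finset.mem_union, Finset.mem_filter, Finset.mem_univ, true_and]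
      refine ⟨j, ?_⟩
      simp only [edge, Sym2.eq_iff] at hj
      tauto
    refine (Finset.card_le_card hsub).trans ?_
    refine (Finset.card_biUnion_le_card_mul _ _ (2 * D ^ k) ?_).trans (by simp; apply le_of_eq; ring)
    intro j _
    refine (Finset.card_union_le _ _).trans ?_
    have h1 := count_walk (G m) D hD (hdeg m) k j.castSucc u
    have h2 := count_walk (G m) D hD (hdeg m) k j.castSucc v
    omega
  obtain ⟨c, hc⟩ := rosen s a β hβ (by
    intro e
    have h1 : ∑ x with e ∈ s x, β * (β ^ (s x).card)⁻¹ ≤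
        ∑ n : Fin m, β * ((2 * (k n : ℝ) * (D : ℝ) ^ k n) *
          (Fintype.card (V n) * (D : ℝ) ^ k n) * (β ^ k n)⁻¹) := by
      simp only [hs]
      rw [Finset.sum_filter, Fintype.sum_sigma]
      apply Finset.sum_le_sum
      intro n _
      rw [Fintype.sum_prod_type]
      have h2 : ∀ p : {p : Fin (k n + 1) → V m // IsW (G m) p ∧ Function.Injective p},
          ∑ q : {q : Fin (k n + 1) → V n // IsW (G n) q},
            (if e ∈ s ⟨n, p, q⟩ then β * (β ^ k n)⁻¹ else 0) =
          if e ∈ Finset.univ.image (edge p.1) then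
            (Fintype.card {q : Fin (k n + 1) → V n // IsW (G n) q} : ℝ) * (β * (β ^ k n)⁻¹) else 0 := by
        intro p
        simp only [s]
        split_ifs
        · simp
        · simp
      rw [Finset.sum_congr rfl (fun p _ => h2 p), ← Finset.sum_filter, Finset.sum_const, nsmul_eq_mul]
      have h3 : (Fintype.card {q : Fin (k n + 1) → V n // IsW (G n) q} : ℝ) ≤
        Fintype.card (V n) * (D : ℝ) ^ k n := by exact_mod_cast hq n
      have h4 : (((Finset.univ.filter
        (fun p : {p : Fin (k n + 1) → V m // IsW (G m) p ∧ Function.Injective p} =>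
        e ∈ Finset.univ.image (edge p.1))).card : ℕ) : ℝ) ≤ 2 * k n * (D : ℝ) ^ k n := by
        exact_mod_cast hp e (k n)
      calc _ ≤ (2 * k n * (D : ℝ) ^ k n) * ((Fintype.card (V n) * (D : ℝ) ^ k n) * (β * (β ^ k n)⁻¹)) := by
            gcongr
        _ = _ := by ring
    refine h1.trans ?_
    rw [← Finset.mul_sum, Fin.sum_univ_eq_sum_range (fun n => (2 * (k n : ℝ) * (D : ℝ) ^ k n) *
          (Fintype.card (V n) * (D : ℝ) ^ k n) * (β ^ k n)⁻¹)]
    nlinarith)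
  refine ⟨fun u v => c s(u, v), fun u v => congrArg c Sym2.eq_swap, ?_⟩
  intro n hn f g hf hg hall
  have hinj := nb_inj (G m) (k n) g (hk n hn) hg
  let p : Fin (k n + 1) → V m := fun i => g i
  let q : Fin (k n + 1) → V n := fun i => f i
  have hpI : Function.Injective p := by
    intro i j hij
    by_contra hne
    have hne' : i.1 ≠ j.1 := fun h => hne (Fin.ext h)
    rcases Nat.lt_or_gt_of_ne hne' with h | h
    · apply hinj (j.1 - i.1) i.1 (by omega) (by omega)
      rw [Nat.add_sub_cancel' h.le]; exact hij
    · apply hinj (i.1 - j.1) j.1 (by omega) (by omega)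
      rw [Nat.add_sub_cancel' h.le]; exact hij.symm
  have hpW : IsW (G m) p := fun i => hg.1 i.1 i.2
  have hqW : IsW (G n) q := fun i => hf.1 i.1 i.2
  let x : I := ⟨⟨n, hn⟩, ⟨p, hpW, hpI⟩, ⟨q, hqW⟩⟩
  obtain ⟨e, he, hne⟩ := hc x (by rw [← Finset.card_pos, hs]; exact hk0 n hn)
  simp only [s, Finset.mem_image, Finset.mem_univ, true_and] at he
  obtain ⟨i, rfl⟩ := he
  apply hne
  have h1 : a x (edge x.2.1.1 i) = l n (q i.castSucc) (q i.succ) :=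
    (edge_inj p hpI).extend_apply _ _ i
  rw [h1]
  exact (hall i.1 i.2).symm

/-- For a sequence of disjoint finite connected graphs of degree at most `D ≥ 3`, with girths
growing to infinity, `girth (Θ n) < girth (Θ (n+1))`, `diam ≤ A·girth` and `λ·girth > 1`,
there exists a sequence of labellings over a common symmetrized set of
`L = ⌈2·D·e⁴·D^(2A/λ+1)⌉` labels such that for every `n`, no labeling of a path of length at
least `λ·girth (Θ n)` in `Θ n` appears as a labeling of a path in `Θ n'` for `n' ≠ n`. -/
theorem statement_2 (D : ℕ) (hD : 3 ≤ D) (A lam : ℝ) (hA : 0 < A)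
    (hlam0 : 0 < lam) (hlam6 : lam ≤ 1 / 6)
    (V : ℕ → Type) [∀ n, Fintype (V n)]
    (G : ∀ n, SimpleGraph (V n)) [∀ n, DecidableRel (G n).Adj]
    (hconn : ∀ n, (G n).Connected)
    (hdeg : ∀ n, ∀ v : V n, (G n).degree v ≤ D)
    (hgrow : Filter.Tendsto (fun n => (G n).girth) Filter.atTop Filter.atTop)
    (hmono : ∀ n, (G n).girth < (G (n + 1)).girth)
    (hdiam : ∀ n, ((G n).diam : ℝ) ≤ A * ((G n).girth : ℝ))
    (hgirth : ∀ n, 1 < lam * ((G n).girth : ℝ))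
    (L : ℕ) (hL : L = ⌈2 * (D : ℝ) * Real.exp 1 ^ 4 * (D : ℝ) ^ (2 * A / lam + 1)⌉₊) :
    ∃ (Λ : Type) (instΛ : Fintype Λ) (bar : Λ → Λ), Function.Involutive bar ∧
      @Fintype.card Λ instΛ = L ∧
      ∃ l : ∀ n, V n → V n → Λ,
        (∀ n, IsLabeling (G n) bar (l n)) ∧
        ∀ n n' : ℕ, n ≠ n' → ∀ (k : ℕ) (f : ℕ → V n) (g : ℕ → V n'),
          lam * ((G n).girth : ℝ) ≤ (k : ℝ) →
          IsNBPath (G n) k f → IsNBPath (G n') k g →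
          ¬ (∀ m, m < k → l n (f m) (f (m + 1)) = l n' (g m) (g (m + 1))) := by
  classical
  have hD0 : (0 : ℝ) < D := by exact_mod_cast (by omega : 0 < D)
  have hstrict : StrictMono (fun n => (G n).girth) := strictMono_nat_of_lt_succ hmono
  set β : ℝ := (L : ℝ) / 2 with hβdef
  have hβB : (D : ℝ) ^ (2 * A / lam + 2) * Real.exp 1 ^ 4 ≤ β := by
    have h1 : 2 * (D : ℝ) * Real.exp 1 ^ 4 * (D : ℝ) ^ (2 * A / lam + 1) ≤ L := by
      rw [hL]; exact Nat.le_ceil _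
    have h2 : (D : ℝ) ^ (2 * A / lam + 2) = D * (D : ℝ) ^ (2 * A / lam + 1) := by
      rw [show 2 * A / lam + 2 = 2 * A / lam + 1 + 1 by ring, Real.rpow_add_one hD0.ne']
      ring
    rw [h2, hβdef]
    linarith
  have hβ : 0 < β := lt_of_lt_of_le (by positivity) hβB
  have hL0 : 0 < L := by
    have : (0 : ℝ) < L := by linarith
    exact_mod_cast this
  have : NeZero L := ⟨by omega⟩
  let kk : ℕ → ℕ := fun n => ⌈lam * ((G n).girth : ℝ)⌉₊
  have hg0 : ∀ n, (6 : ℝ) < (G n).girth := by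
    intro n
    have := hgirth n
    have h0 : (0 : ℝ) ≤ (G n).girth := by positivity
    nlinarith
  have hkk0 : ∀ n, 0 < kk n := fun n => Nat.ceil_pos.2 (by linarith [hgirth n])
  have hkkg : ∀ n, kk n < (G n).girth := by
    intro n
    have h1 : (kk n : ℝ) < lam * (G n).girth + 1 := Nat.ceil_lt_add_one (by linarith [hgirth n])
    have h2 := hg0 n
    have : (kk n : ℝ) < (G n).girth := by nlinarith
    exact_mod_cast this
  have H : ∀ (m : ℕ) (l : ∀ n, V n → V n → Fin L), ∃ c : V m → V m → Fin L,
      (∀ u v, c v u = c u v) ∧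
      ∀ n < m, ∀ (f : ℕ → V n) (g : ℕ → V m), IsNBPath (G n) (kk n) f → IsNBPath (G m) (kk n) g →
        ¬ ∀ i < kk n, l n (f i) (f (i+1)) = c (g i) (g (i+1)) := by
    intro m l
    refine step D hD V G hdeg m kk (fun n _ => hkk0 n)
      (fun n hn => (hkkg n).trans (hstrict hn)) β hβ ?_ (by simp [hβdef]; linarith) l
    refine (Finset.sum_le_sum ?_).trans
      (sum_bound lam hlam0 hlam6 (fun n => (G n).girth) hmono (hgirth 0) m)
    intro n _
    refine term_bound D hD A lam hA hlam0 (G n).girth (G n).diam (Fintype.card (V n)) (kk n)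
      (card_le_diam (G n) D hD (hdeg n) (hconn n)) (girth_le_card (G n) ?_) (hdiam n) (hgirth n)
      rfl β hβB
    exact (hkk0 n).trans (hkkg n)
  choose F hF1 hF2 using H
  let Φ : ∀ m, (∀ n, n < m → V n → V n → Fin L) → (V m → V m → Fin L) :=
    fun m r => F m (fun n => if h : n < m then r n h else fun _ _ => 0)
  let l : ∀ n, V n → V n → Fin L := fun n => Nat.lt_wfRel.wf.fix Φ n
  have hl : ∀ m, l m = F m (fun n => if n < m then l n else fun _ _ => 0) := by
    intro m
    have := Nat.lt_wfRel.wf.fix_eq Φ m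
    simpa [Φ] using this
  have key : ∀ n m, n < m → ∀ (f : ℕ → V n) (g : ℕ → V m), IsNBPath (G n) (kk n) f →
      IsNBPath (G m) (kk n) g → ¬ ∀ i < kk n, l n (f i) (f (i+1)) = l m (g i) (g (i+1)) := by
    intro n m hnm f g hf hg hall
    rw [hl m] at hall
    refine hF2 m (fun n => if n < m then l n else fun _ _ => 0) n hnm f g hf hg ?_
    intro i hi
    simp only [if_pos hnm]
    exact hall i hi
  have trunc : ∀ {n : ℕ} {k k' : ℕ} {f : ℕ → V n}, k' ≤ k → IsNBPath (G n) k f →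
      IsNBPath (G n) k' f :=
    fun hk h => ⟨fun i hi => h.1 i (by omega), fun i hi => h.2 i (by omega)⟩
  refine ⟨Fin L, inferInstance, id, fun _ => rfl, by simp, l, ?_, ?_⟩
  · intro n u v _
    rw [hl n]
    exact hF1 n _ u v
  · intro n n' hne k f g hk hf hg hall
    rcases Nat.lt_or_gt_of_ne hne with h | h
    · have hk' : kk n ≤ k := Nat.ceil_le.2 hk
      exact key n n' h f g (trunc hk' hf) (trunc hk' hg) (fun i hi => hall i (by omega))
    · have hk' : kk n' ≤ k := by
        apply Nat.ceil_le.2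
        refine le_trans ?_ hk
        have : ((G n').girth : ℝ) ≤ (G n).girth := by exact_mod_cast (hstrict h).le
        gcongr
      exact key n' n h g f (trunc hk' hg) (trunc hk' hf) (fun i hi => (hall i (by omega)).symm)
end

section
/- C'(λ)-small cancellation labeling of Θ (Theorem 1). Let Θ = (Θ_n)_{n∈ℕ} be a sequence of pairwise disjoint finite connected graphs with all vertex degrees at most D (D ≥ 3 an integer), with girth(Θ_n) → ∞, girth(Θ_n) < girth(Θ_{n+1}), and diam(Θ_n) ≤ A·girth(Θ_n) for a universal constant A > 0, and let λ ∈ (0, 1/6] satisfy λ·girth(Θ_n) > 1 for every n. Then there exist a finite symmetrized set of labels and a labeling m = (m_n)_{n∈ℕ} of Θ over it (m_n a labeling of Θ_n) such that: m is reduced, and for every n, no m_n-labeling of a path of length at least λ·girth(Θ_n) in Θ_n appears as the m-labeling of any path in Θ other than that path itself (in particular, neither as the labeling of a different path in Θ_n, nor as the labeling of a path in Θ_{n'} for n' ≠ n). -/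
/-- A labeling is reduced if no two distinct oriented edges with the same initial vertex
carry the same label. -/
def IsReducedLabeling {V Λ : Type*} (G : SimpleGraph V) (ℓ : V → V → Λ) : Prop :=
  ∀ u v₁ v₂, G.Adj u v₁ → G.Adj u v₂ → v₁ ≠ v₂ → ℓ u v₁ ≠ ℓ u v₂


set_option linter.unusedSectionVars false

namespace Osajda

open Finset

section Counting

variable {E C : Type} [Fintype E] [DecidableEq E] [Fintype C] [DecidableEq C]

/-- An event `(F, S)` holds for a partial colouring `c` if all of `F` is coloured and the word read
along `F` equals the word read along `S` (whose entries are edges or explicit colours). -/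
def EvHolds (c : E → Option C) (p : List E × List (E ⊕ C)) : Prop :=
  p.1.map c = p.2.map (Sum.elim c some) ∧ ∀ x ∈ p.1, c x ≠ none

/-- Erase the colours on `T`. -/
def er (c : E → Option C) (T : Finset E) : E → Option C := fun x => if x ∈ T then none else c x

lemma EvHolds.of_er {c : E → Option C} {T : Finset E} {p : List E × List (E ⊕ C)}
    (h : EvHolds (er c T) p) : EvHolds c p := by
  obtain ⟨h1, h2⟩ := h
  have hF : ∀ x, er c T x ≠ none → er c T x = c x := by
    intro x hx
    unfold er at hx ⊢
    split_ifs at hx ⊢ <;> simp_all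
  have e1 : p.1.map (er c T) = p.1.map c := List.map_congr_left fun x hx => hF x (h2 x hx)
  have e2 : p.2.map (Sum.elim (er c T) some) = p.2.map (Sum.elim c some) := by
    apply List.map_congr_left
    rintro (x | a) hx
    · apply hF
      have : er c T x ∈ p.2.map (Sum.elim (er c T) some) := List.mem_map.2 ⟨_, hx, rfl⟩
      rw [← h1] at this
      obtain ⟨y, hy, hy'⟩ := List.mem_map.1 this
      rw [← hy']; exact h2 y hy
    · rfl
  refine ⟨by rw [← e1, ← e2, h1], fun x hx => ?_⟩
  rw [← hF x (h2 x hx)]; exact h2 x hx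

open Classical in
/-- Partial colourings with domain `S` for which no event holds. -/
noncomputable def goodSet (Ev : Set (List E × List (E ⊕ C))) (S : Finset E) :
    Finset (E → Option C) :=
  univ.filter fun c => (∀ x, c x ≠ none ↔ x ∈ S) ∧ ∀ p ∈ Ev, ¬ EvHolds c p

lemma mem_goodSet {Ev : Set (List E × List (E ⊕ C))} {S : Finset E} {c : E → Option C} :
    c ∈ goodSet Ev S ↔ (∀ x, c x ≠ none ↔ x ∈ S) ∧ ∀ p ∈ Ev, ¬ EvHolds c p := by
  simp [goodSet]

lemma er_mem {Ev : Set (List E × List (E ⊕ C))} {S T : Finset E} {c : E → Option C}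
    (hc : c ∈ goodSet Ev S) : er c T ∈ goodSet Ev (S \ T) := by
  rw [mem_goodSet] at hc ⊢
  refine ⟨fun x => ?_, fun p hp h => hc.2 p hp h.of_er⟩
  have := hc.1 x
  unfold er
  by_cases hx : x ∈ T <;> simp_all

lemma geom_bound (M : ℝ) (hM : 0 < M) (N : ℕ) :
    ∑ l ∈ Finset.Icc 1 N, M ^ l / (2 * M) ^ (l - 1) ≤ 2 * M := by
  have h : ∀ N : ℕ, ∑ l ∈ Finset.Icc 1 N, M ^ l / (2 * M) ^ (l - 1) = 2 * M - M * 2 / 2 ^ N := by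
    intro N
    induction N with
    | zero => simp; ring
    | succ n ih =>
      rw [Finset.sum_Icc_succ_top (by omega), ih]
      simp only [Nat.add_sub_cancel]
      rw [mul_pow, pow_succ, pow_succ]
      field_simp
      ring
  rw [h]
  have : 0 ≤ M * 2 / 2 ^ N := by positivity
  linarith

/-- Rosenfeld-style counting argument replacing the local lemma. -/
theorem step_card (Ev : Set (List E × List (E ⊕ C))) (M : ℕ) (hM : 0 < M)
    (hC : 4 * M ≤ Fintype.card C)
    (h1 : ∀ p ∈ Ev, p.1.Nodup)
    (h3 : ∀ p ∈ Ev, ∀ x, Sum.inl x ∈ p.2 → x ∉ p.1)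
    (h4 : ∀ p ∈ Ev, ∀ x, Sum.inl x ∈ p.2 → ∃ G : List E, p.2 = G.map Sum.inl ∧
      (G, p.1.map Sum.inl) ∈ Ev)
    (Φ : E → ℕ → Finset (List E × List (E ⊕ C)))
    (h5 : ∀ p ∈ Ev, ∀ e ∈ p.1, p ∈ Φ e p.1.length)
    (h6 : ∀ e l, 1 ≤ l → (Φ e l).card ≤ M ^ l)
    (n : ℕ) : ∀ (S : Finset E), S.card = n → ∀ e ∉ S,
      2 * M * (goodSet Ev S).card ≤ (goodSet Ev (insert e S)).card := by
  classical
  induction n using Nat.strong_induction_on with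
  | _ n ih =>
  intro S hS e he
  -- iterated bound
  have iter : ∀ T : Finset E, T ⊆ S →
      (2 * M) ^ T.card * (goodSet Ev (S \ T)).card ≤ (goodSet Ev S).card := by
    intro T
    induction T using Finset.induction_on with
    | empty => simp
    | insert a T ha ihT =>
      intro hT
      have hTS : T ⊆ S := (Finset.subset_insert _ _).trans hT
      have haS : a ∈ S := hT (Finset.mem_insert_self _ _)
      have e1 : insert a (S \ insert a T) = S \ T := by
        ext x; simp only [Finset.mem_insert, Finset.mem_sdiff]
        by_cases hx : x = a
        · subst hx; simp [haS, ha]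
        · simp [hx]
      have hlt : (S \ insert a T).card < n := by
        rw [← hS]
        apply Finset.card_lt_card
        refine ⟨Finset.sdiff_subset, fun h => ?_⟩
        have := h haS
        simp at this
      have := ih _ hlt (S \ insert a T) rfl a (by simp)
      rw [e1] at this
      calc (2 * M) ^ (insert a T).card * (goodSet Ev (S \ insert a T)).card
          = (2 * M) ^ T.card * (2 * M * (goodSet Ev (S \ insert a T)).card) := by
            rw [Finset.card_insert_of_notMem ha]; ring
        _ ≤ (2 * M) ^ T.card * (goodSet Ev (S \ T)).card := Nat.mul_le_mul_left _ this
        _ ≤ _ := ihT hTS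
  set Y : Finset (E → Option C) :=
    ((goodSet Ev S) ×ˢ (univ : Finset C)).image (fun q => Function.update q.1 e (some q.2)) with hY
  have hnone : ∀ c ∈ goodSet Ev S, c e = none := by
    intro c hc
    have := ((mem_goodSet.1 hc).1 e).not.2 he
    simpa using this
  have hYcard : Y.card = (goodSet Ev S).card * Fintype.card C := by
    rw [hY, Finset.card_image_of_injOn, Finset.card_product, Finset.card_univ]
    rintro ⟨c, a⟩ hc ⟨c', a'⟩ hc' h
    simp only [Finset.coe_product, Set.mem_prod, Finset.mem_coe] at hc hc'
    simp only at h
    have ha : a = a' := by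
      have := congrFun h e
      simpa using this
    have hcc : c = c' := by
      funext x
      by_cases hx : x = e
      · subst hx; rw [hnone c hc.1, hnone c' hc'.1]
      · have := congrFun h x
        simpa [hx] using this
    rw [ha, hcc]
  have hYer : ∀ c ∈ Y, ∀ T : Finset E, e ∈ T → er c T ∈ goodSet Ev (S \ T) := by
    intro c hc T hT
    rw [hY, Finset.mem_image] at hc
    obtain ⟨⟨c0, a⟩, hc0, rfl⟩ := hc
    rw [Finset.mem_product] at hc0
    have : er (Function.update c0 e (some a)) T = er c0 T := by
      funext x
      unfold er
      by_cases hx : x ∈ T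
      · simp [hx]
      · have : x ≠ e := by rintro rfl; exact hx hT
        simp [hx, this]
    simp only
    rw [this]
    exact er_mem hc0.1
  have hYdom : ∀ c ∈ Y, ∀ x, c x ≠ none ↔ x ∈ insert e S := by
    intro c hc x
    rw [hY, Finset.mem_image] at hc
    obtain ⟨⟨c0, a⟩, hc0, rfl⟩ := hc
    rw [Finset.mem_product] at hc0
    have := (mem_goodSet.1 hc0.1).1 x
    by_cases hx : x = e
    · subst hx; simp
    · simp only [Function.update_of_ne hx, this, Finset.mem_insert, hx, false_or]
  let Ψ : ℕ → Finset (List E × List (E ⊕ C)) := fun l =>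
    (Φ e l).filter fun p => p ∈ Ev ∧ p.1.length = l ∧ e ∈ p.1 ∧ p.1.toFinset ⊆ insert e S
  let Z : List E × List (E ⊕ C) → Finset (E → Option C) := fun p => Y.filter fun c => EvHolds c p
  have hcover : Y ⊆ goodSet Ev (insert e S) ∪
      (Finset.Icc 1 (Fintype.card E)).biUnion fun l => (Ψ l).biUnion Z := by
    intro c hc
    by_cases hg : c ∈ goodSet Ev (insert e S)
    · exact Finset.mem_union_left _ hg
    apply Finset.mem_union_right
    rw [mem_goodSet] at hg
    have hex : ∃ p ∈ Ev, EvHolds c p := by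
      by_contra hcon
      push Not at hcon
      exact hg ⟨hYdom c hc, hcon⟩
    have key : ∃ p ∈ Ev, EvHolds c p ∧ e ∈ p.1 := by
      obtain ⟨p, hp, hpc⟩ := hex
      by_cases hep : e ∈ p.1
      · exact ⟨p, hp, hpc, hep⟩
      by_cases hep2 : Sum.inl e ∈ p.2
      · obtain ⟨G, hG, hG'⟩ := h4 p hp e hep2
        have hGm : G.map c = p.1.map c := by
          rw [hpc.1, hG, List.map_map]; rfl
        refine ⟨_, hG', ⟨?_, ?_⟩, ?_⟩
        · simp only [List.map_map]
          rw [hGm]; rfl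
        · intro x hx hxn
          have : c x ∈ G.map c := List.mem_map.2 ⟨x, hx, rfl⟩
          rw [hGm] at this
          obtain ⟨y, hy, hyx⟩ := List.mem_map.1 this
          exact hpc.2 y hy (hyx.trans hxn)
        · rw [hG] at hep2
          simpa using hep2
      · exfalso
        have hgood := hYer c hc {e} (by simp)
        refine (mem_goodSet.1 hgood).2 p hp ?_
        have hne : ∀ x, x ≠ e → er c {e} x = c x := by
          intro x hx; simp [er, hx]
        have e1 : p.1.map (er c {e}) = p.1.map c :=
          List.map_congr_left fun x hx => hne x (by rintro rfl; exact hep hx)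
        have e2 : p.2.map (Sum.elim (er c {e}) some) = p.2.map (Sum.elim c some) := by
          apply List.map_congr_left
          rintro (x | a) hx
          · exact hne x (by rintro rfl; exact hep2 hx)
          · rfl
        refine ⟨by rw [e1, e2, hpc.1], fun x hx => ?_⟩
        rw [hne x (by rintro rfl; exact hep hx)]
        exact hpc.2 x hx
    obtain ⟨p, hp, hpc, hep⟩ := key
    simp only [Finset.mem_biUnion, Finset.mem_Icc]
    refine ⟨p.1.length, ⟨List.length_pos_of_mem hep, ?_⟩, p, ?_, ?_⟩
    · exact (h1 p hp).length_le_card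
    · simp only [Ψ, Finset.mem_filter]
      refine ⟨h5 p hp e hep, hp, trivial, hep, ?_⟩
      intro x hx
      rw [List.mem_toFinset] at hx
      exact (hYdom c hc x).1 (hpc.2 x hx)
    · simp only [Z, Finset.mem_filter]
      exact ⟨hc, hpc⟩
  have hZ : ∀ l, ∀ p ∈ Ψ l, (2 * M) ^ (l - 1) * (Z p).card ≤ (goodSet Ev S).card := by
    intro l p hp
    simp only [Ψ, Finset.mem_filter] at hp
    obtain ⟨-, hpE, hpl, hep, hsub⟩ := hp
    have hinj : (Z p).card ≤ (goodSet Ev (S \ p.1.toFinset)).card := by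
      apply Finset.card_le_card_of_injOn (fun c => er c p.1.toFinset)
      · intro c hc
        have hc' : c ∈ Z p := hc
        simp only [Z, Finset.mem_filter] at hc'
        exact hYer c hc'.1 _ (by simpa using hep)
      · intro c hc c' hc' h
        have hc1 : c ∈ Z p := hc
        have hc1' : c' ∈ Z p := hc'
        simp only [Z, Finset.mem_filter] at hc1 hc1'
        have hoff : ∀ x, x ∉ p.1 → c x = c' x := by
          intro x hx
          have := congrFun h x
          simpa [er, hx] using this
        have hm : p.1.map c = p.1.map c' := by
          rw [hc1.2.1, hc1'.2.1]
          apply List.map_congr_left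
          rintro (x | a) hx
          · exact hoff x (h3 p hpE x hx)
          · rfl
        funext x
        by_cases hx : x ∈ p.1
        · exact List.map_inj_left.1 hm x hx
        · exact hoff x hx
    have hE : S \ p.1.toFinset = S \ (p.1.toFinset.erase e) := by
      ext x
      simp only [Finset.mem_sdiff, Finset.mem_erase]
      constructor
      · rintro ⟨a, b⟩; exact ⟨a, fun h => b h.2⟩
      · rintro ⟨a, b⟩
        refine ⟨a, fun h => b ⟨?_, h⟩⟩
        rintro rfl; exact he a
    have hcard : (p.1.toFinset.erase e).card = l - 1 := by
      rw [Finset.card_erase_of_mem (by simpa using hep), List.toFinset_card_of_nodup (h1 p hpE), hpl]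
    have := iter (p.1.toFinset.erase e) (by
      intro x hx
      rw [Finset.mem_erase] at hx
      have := hsub hx.2
      simpa [hx.1] using this)
    rw [hcard, ← hE] at this
    exact (Nat.mul_le_mul_left _ hinj).trans this
  have hMr : (0 : ℝ) < M := by exact_mod_cast hM
  set X : ℝ := ((goodSet Ev S).card : ℝ) with hX
  have hX0 : 0 ≤ X := by positivity
  have hZr : ∀ l, ∀ p ∈ Ψ l, ((Z p).card : ℝ) ≤ X / (2 * M) ^ (l - 1) := by
    intro l p hp
    rw [le_div_iff₀ (by positivity)]
    have := hZ l p hp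
    have h' : (((2 * M) ^ (l - 1) * (Z p).card : ℕ) : ℝ) ≤ X := by rw [hX]; exact_mod_cast this
    push_cast at h'
    linarith
  have hbad : ((((Finset.Icc 1 (Fintype.card E)).biUnion fun l => (Ψ l).biUnion Z).card : ℕ) : ℝ)
      ≤ 2 * M * X := by
    calc ((((Finset.Icc 1 (Fintype.card E)).biUnion fun l => (Ψ l).biUnion Z).card : ℕ) : ℝ)
        ≤ ((∑ l ∈ Finset.Icc 1 (Fintype.card E), ∑ p ∈ Ψ l, (Z p).card : ℕ) : ℝ) := by
          apply Nat.cast_le.2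
          exact Finset.card_biUnion_le.trans (Finset.sum_le_sum fun l _ => Finset.card_biUnion_le)
      _ = ∑ l ∈ Finset.Icc 1 (Fintype.card E), ∑ p ∈ Ψ l, ((Z p).card : ℝ) := by push_cast; rfl
      _ ≤ ∑ l ∈ Finset.Icc 1 (Fintype.card E), (M : ℝ) ^ l / (2 * M) ^ (l - 1) * X := by
          apply Finset.sum_le_sum
          intro l hl
          rw [Finset.mem_Icc] at hl
          calc ∑ p ∈ Ψ l, ((Z p).card : ℝ) ≤ ∑ p ∈ Ψ l, X / (2 * M) ^ (l - 1) :=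
                Finset.sum_le_sum (hZr l)
            _ = (Ψ l).card * (X / (2 * M) ^ (l - 1)) := by rw [Finset.sum_const, nsmul_eq_mul]
            _ ≤ (M : ℝ) ^ l * (X / (2 * M) ^ (l - 1)) := by
                apply mul_le_mul_of_nonneg_right _ (by positivity)
                have : (Ψ l).card ≤ M ^ l :=
                  (Finset.card_le_card (Finset.filter_subset _ _)).trans (h6 e l hl.1)
                exact_mod_cast this
            _ = _ := by ring
      _ = (∑ l ∈ Finset.Icc 1 (Fintype.card E), (M : ℝ) ^ l / (2 * M) ^ (l - 1)) * X := by
          rw [Finset.sum_mul]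
      _ ≤ 2 * M * X := mul_le_mul_of_nonneg_right (geom_bound M hMr _) hX0
  have htot : (Y.card : ℝ) ≤ ((goodSet Ev (insert e S)).card : ℝ) + 2 * M * X := by
    have := (Finset.card_le_card hcover).trans (Finset.card_union_le _ _)
    have h' : (Y.card : ℝ) ≤ ((goodSet Ev (insert e S)).card : ℝ) +
      ((((Finset.Icc 1 (Fintype.card E)).biUnion fun l => (Ψ l).biUnion Z).card : ℕ) : ℝ) := by
      exact_mod_cast this
    linarith
  have hYr : (4 * M : ℝ) * X ≤ Y.card := by
    rw [hYcard, hX]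
    have : 4 * M * (goodSet Ev S).card ≤ (goodSet Ev S).card * Fintype.card C := by
      rw [mul_comm]; exact Nat.mul_le_mul_left _ hC
    exact_mod_cast this
  have : (2 * M : ℝ) * X ≤ (goodSet Ev (insert e S)).card := by linarith
  rw [hX] at this
  exact_mod_cast this

theorem exists_coloring (Ev : Set (List E × List (E ⊕ C))) (M : ℕ) (hM : 0 < M)
    (hC : 4 * M ≤ Fintype.card C)
    (h1 : ∀ p ∈ Ev, p.1.Nodup) (h2 : ∀ p ∈ Ev, p.1 ≠ [])
    (h3 : ∀ p ∈ Ev, ∀ x, Sum.inl x ∈ p.2 → x ∉ p.1)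
    (h4 : ∀ p ∈ Ev, ∀ x, Sum.inl x ∈ p.2 → ∃ G : List E, p.2 = G.map Sum.inl ∧
      (G, p.1.map Sum.inl) ∈ Ev)
    (Φ : E → ℕ → Finset (List E × List (E ⊕ C)))
    (h5 : ∀ p ∈ Ev, ∀ e ∈ p.1, p ∈ Φ e p.1.length)
    (h6 : ∀ e l, 1 ≤ l → (Φ e l).card ≤ M ^ l) :
    ∃ c : E → C, ∀ p ∈ Ev, p.1.map c ≠ p.2.map (Sum.elim c id) := by
  classical
  have hpos : ∀ S : Finset E, 0 < (goodSet Ev S).card := by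
    intro S
    induction S using Finset.induction_on with
    | empty =>
      apply Finset.card_pos.2
      refine ⟨fun _ => none, ?_⟩
      rw [mem_goodSet]
      refine ⟨by simp, fun p hp h => ?_⟩
      obtain ⟨x, hx⟩ := List.exists_mem_of_ne_nil _ (h2 p hp)
      exact h.2 x hx rfl
    | insert a S ha ih =>
      refine lt_of_lt_of_le ?_ (step_card Ev M hM hC h1 h3 h4 Φ h5 h6 _ S rfl a ha)
      positivity
  obtain ⟨c, hc⟩ := Finset.card_pos.1 (hpos univ)
  rw [mem_goodSet] at hc
  have hs : ∀ x, ∃ a, c x = some a := fun x => Option.ne_none_iff_exists'.1 ((hc.1 x).2 (by simp))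
  choose d hd using hs
  refine ⟨d, fun p hp h => hc.2 p hp ⟨?_, fun x _ => (hc.1 x).2 (by simp)⟩⟩
  have := congrArg (List.map some) h
  rw [List.map_map, List.map_map] at this
  convert this using 1
  · exact List.map_congr_left fun x _ => hd x
  · apply List.map_congr_left
    rintro (x | a) _
    · exact hd x
    · rfl

end Counting

end Osajda

namespace Osajda

open Finset

section Graph

variable {V : Type} {G : SimpleGraph V}

/-- The list of edges of the walk `f` of length `l`. -/
def edgesOf (f : ℕ → V) (l : ℕ) : List (Sym2 V) := (List.range l).map fun i => s(f i, f (i + 1))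

lemma mem_edgesOf {f : ℕ → V} {l : ℕ} {e : Sym2 V} :
    e ∈ edgesOf f l ↔ ∃ i < l, s(f i, f (i + 1)) = e := by
  simp [edgesOf]

lemma edgesOf_succ (f : ℕ → V) (l : ℕ) :
    edgesOf f (l + 1) = s(f 0, f 1) :: edgesOf (fun i => f (i + 1)) l := by
  simp [edgesOf, List.range_succ_eq_map, Function.comp_def]

lemma length_edgesOf (f : ℕ → V) (l : ℕ) : (edgesOf f l).length = l := by simp [edgesOf]

lemma map_edgesOf_eq {C V' : Type} (c : Sym2 V → C) (c' : Sym2 V' → C) (f : ℕ → V) (g : ℕ → V')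
    (l : ℕ) : (edgesOf f l).map c = (edgesOf g l).map c' ↔
      ∀ i < l, c s(f i, f (i + 1)) = c' s(g i, g (i + 1)) := by
  simp only [edgesOf, List.map_map]
  rw [List.map_inj_left]
  simp

/-- `f` is a walk of length `l`. -/
def IsW (G : SimpleGraph V) (l : ℕ) (f : ℕ → V) : Prop := ∀ i, i < l → G.Adj (f i) (f (i + 1))

lemma exists_walk (l : ℕ) (f : ℕ → V) (h : IsW G l f) :
    ∃ p : G.Walk (f 0) (f l), p.length = l ∧ p.support = (List.range (l + 1)).map f ∧
      p.edges = edgesOf f l := by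
  induction l with
  | zero => exact ⟨SimpleGraph.Walk.nil, by simp [edgesOf]⟩
  | succ n ih =>
    obtain ⟨p, h1, h2, h3⟩ := ih (fun i hi => h i (by omega))
    refine ⟨p.concat (h n (by omega)), by simp [h1], ?_, ?_⟩
    · rw [SimpleGraph.Walk.support_concat, h2, List.range_succ (n := n + 1)]
      simp
    · rw [SimpleGraph.Walk.edges_concat, h3]
      simp [edgesOf, List.range_succ]

/-- Non-backtracking paths shorter than the girth are injective. -/
lemma nb_inj {n : ℕ} {f : ℕ → V} (h : IsNBPath G n f) (hn : n < G.girth) :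
    ∀ i j, i ≤ n → j ≤ n → f i = f j → i = j := by
  classical
  by_contra hcon
  have hex : ∃ j, j ≤ n ∧ ∃ i < j, f i = f j := by
    push Not at hcon
    obtain ⟨i, j, hi, hj, hij, hne⟩ := hcon
    rcases lt_or_gt_of_ne hne with h' | h'
    · exact ⟨j, hj, i, h', hij⟩
    · exact ⟨i, hi, j, h', hij.symm⟩
  obtain ⟨hjn, i, hij, hfe⟩ := Nat.find_spec hex
  have hmin : ∀ b, b < Nat.find hex → ∀ a, a < b → f a ≠ f b := by
    intro b hb a ha hab
    exact Nat.find_min hex hb ⟨by omega, a, ha, hab⟩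
  set j := Nat.find hex with hj
  have hj1 : j ≠ i + 1 := by
    intro h'
    have := h.1 i (by omega)
    rw [← h', ← hfe] at this
    exact G.loopless.irrefl _ this
  have hj2 : j ≠ i + 2 := by
    intro h'
    exact h.2 i (by omega) (by rw [← h', ← hfe])
  have hinj : ∀ a b, i + 1 ≤ a → a < b → b ≤ j → f a ≠ f b := by
    intro a b ha hab hb he
    rcases Nat.lt_or_ge b j with h' | h'
    · exact hmin b h' a hab he
    · have : b = j := by omega
      subst this
      exact hmin a hab i (by omega) (hfe.trans he.symm)
  obtain ⟨p, hp1, hp2, hp3⟩ := exists_walk (G := G) (j - (i + 1)) (fun t => f (i + 1 + t))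
    (fun t ht => h.1 _ (by omega))
  have hend : f (i + 1 + (j - (i + 1))) = f i := by rw [hfe]; congr 1; omega
  let q : G.Walk (f (i + 1)) (f i) := p.copy rfl hend
  have hcyc : (SimpleGraph.Walk.cons (h.1 i (by omega)) q).IsCycle := by
    rw [SimpleGraph.Walk.cons_isCycle_iff]
    constructor
    · rw [SimpleGraph.Walk.isPath_def, SimpleGraph.Walk.support_copy, hp2]
      apply List.Nodup.map_on _ List.nodup_range
      intro a ha b hb hab
      rw [List.mem_range] at ha hb
      by_contra hne
      rcases lt_or_gt_of_ne hne with h' | h'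
      · exact hinj _ _ (by omega) (by omega) (by omega) hab
      · exact hinj _ _ (by omega) (by omega) (by omega) hab.symm
    · rw [SimpleGraph.Walk.edges_copy, hp3, mem_edgesOf]
      rintro ⟨t, ht, hte⟩
      rw [hfe, Sym2.eq_iff] at hte
      rcases hte with ⟨h1, -⟩ | ⟨h1, h2⟩
      · exact hinj _ _ (by omega) (by omega) (le_refl j) h1
      · have ht0 : t = 0 := by
          by_contra hne
          exact hinj (i + 1) (i + 1 + t) (by omega) (by omega) (by omega) h1.symm
        subst ht0
        exact hinj (i + 1 + (0 + 1)) j (by omega) (by omega) (le_refl j) h2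
  have := SimpleGraph.girth_le_length hcyc
  simp only [SimpleGraph.Walk.length_cons, q, SimpleGraph.Walk.length_copy, hp1] at this
  omega

lemma edge_inj {n : ℕ} {f : ℕ → V} (h : ∀ i j, i ≤ n → j ≤ n → f i = f j → i = j) {i j : ℕ}
    (hi : i < n) (hj : j < n) (he : s(f i, f (i + 1)) = s(f j, f (j + 1))) : i = j := by
  rw [Sym2.eq_iff] at he
  rcases he with ⟨h1, -⟩ | ⟨h1, h2⟩
  · exact h _ _ hi.le hj.le h1
  · have := h _ _ (by omega) (by omega) h1
    have := h _ _ (by omega) (by omega) h2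
    omega

lemma nodup_edgesOf {n : ℕ} {f : ℕ → V} (h : IsNBPath G n f) (hn : n < G.girth) :
    (edgesOf f n).Nodup := by
  apply List.Nodup.map_on _ List.nodup_range
  intro a ha b hb hab
  rw [List.mem_range] at ha hb
  exact edge_inj (nb_inj h hn) ha hb hab

lemma IsNBPath_shift {n a m : ℕ} {f : ℕ → V} (h : IsNBPath G n f) (ha : a + m ≤ n) :
    IsNBPath G m (fun t => f (a + t)) :=
  ⟨fun i hi => h.1 (a + i) (by omega), fun i hi => h.2 (a + i) (by omega)⟩

/-- Concatenation of two walks. -/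
def glue (f : ℕ → V) (p : ℕ) (g : ℕ → V) : ℕ → V := fun t => if t ≤ p then f t else g (t - p)

lemma glue_left (f : ℕ → V) {p : ℕ} (g : ℕ → V) {t : ℕ} (h : t ≤ p) : glue f p g t = f t := by
  simp [glue, h]

lemma glue_right (f : ℕ → V) {p : ℕ} (g : ℕ → V) (h0 : f p = g 0) (t : ℕ) :
    glue f p g (p + t) = g t := by
  unfold glue
  split_ifs with h
  · have : t = 0 := by omega
    subst this; exact h0
  · congr 1; omega

lemma glue_nb {f g : ℕ → V} {p q : ℕ} (hf : IsNBPath G p f) (hg : IsNBPath G q g)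
    (h0 : f p = g 0) (hj : 1 ≤ p → 1 ≤ q → f (p - 1) ≠ g 1) :
    IsNBPath G (p + q) (glue f p g) := by
  constructor
  · intro i hi
    rcases Nat.lt_or_ge i p with h | h
    · rw [glue_left f g h.le, glue_left f g h]; exact hf.1 i h
    · obtain ⟨t, rfl⟩ := Nat.exists_eq_add_of_le h
      rw [glue_right f g h0, add_assoc, glue_right f g h0]
      exact hg.1 t (by omega)
  · intro i hi
    rcases Nat.lt_or_ge (i + 1) p with h | h
    · rw [glue_left f g (by omega), glue_left f g (by omega)]; exact hf.2 i h
    · rcases Nat.lt_or_ge i p with h' | h'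
      · have hp : p = i + 1 := by omega
        subst hp
        have := glue_right f g h0 1
        rw [show i + 2 = i + 1 + 1 by ring, this, glue_left f g (by omega)]
        exact hj (by omega) (by omega)
      · obtain ⟨t, rfl⟩ := Nat.exists_eq_add_of_le h'
        rw [glue_right f g h0, add_assoc, glue_right f g h0]
        exact hg.2 t (by omega)

variable [Fintype V] [DecidableEq V] [DecidableRel G.Adj]

variable (G) in
/-- Edge lists of walks of length `l` from `v`. -/
def EP : ℕ → V → Finset (List (Sym2 V))
  | 0, _ => {[]}
  | l + 1, v => (G.neighborFinset v).biUnion fun u => (EP l u).image (fun L => s(v, u) :: L)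

variable (G) in
/-- Vertices within distance `l` of `v`. -/
def bal : ℕ → V → Finset V
  | 0, v => {v}
  | l + 1, v => (insert v (G.neighborFinset v)).biUnion fun u => bal l u

lemma card_EP {K : ℕ} (hK : ∀ v, G.degree v + 1 ≤ K) (l : ℕ) (v : V) :
    (EP G l v).card ≤ K ^ l := by
  induction l generalizing v with
  | zero => simp [EP]
  | succ l ih =>
    rw [EP]
    refine (Finset.card_biUnion_le_card_mul _ _ (K ^ l)
      (fun u _ => Finset.card_image_le.trans (ih u))).trans ?_
    rw [G.card_neighborFinset_eq_degree, pow_succ, mul_comm]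
    exact Nat.mul_le_mul_left _ (by have := hK v; omega)

lemma card_bal {K : ℕ} (hK : ∀ v, G.degree v + 1 ≤ K) (l : ℕ) (v : V) :
    (bal G l v).card ≤ K ^ l := by
  induction l generalizing v with
  | zero => simp [bal]
  | succ l ih =>
    rw [bal]
    refine (Finset.card_biUnion_le_card_mul _ _ (K ^ l) (fun u _ => ih u)).trans ?_
    rw [pow_succ, mul_comm]
    apply Nat.mul_le_mul_left
    refine (Finset.card_insert_le _ _).trans ?_
    rw [G.card_neighborFinset_eq_degree]
    exact hK v

lemma mem_EP (l : ℕ) (f : ℕ → V) (h : IsW G l f) : edgesOf f l ∈ EP G l (f 0) := by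
  induction l generalizing f with
  | zero => simp [EP, edgesOf]
  | succ l ih =>
    rw [EP, edgesOf_succ]
    simp only [Finset.mem_biUnion, Finset.mem_image, SimpleGraph.mem_neighborFinset]
    exact ⟨f 1, h 0 (by omega), _, ih (fun i => f (i + 1)) (fun i hi => h (i + 1) (by omega)), rfl⟩

lemma self_mem_bal (l : ℕ) (v : V) : v ∈ bal G l v := by
  induction l with
  | zero => simp [bal]
  | succ l ih =>
    rw [bal, Finset.mem_biUnion]
    exact ⟨v, by simp, ih⟩

lemma walk_mem_bal {u v : V} (p : G.Walk u v) : ∀ l, p.length ≤ l → v ∈ bal G l u := by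
  induction p with
  | nil => intro l _; exact self_mem_bal l _
  | cons h p ih =>
    intro l hl
    rw [SimpleGraph.Walk.length_cons] at hl
    obtain ⟨l, rfl⟩ := Nat.exists_eq_add_of_le' (show 1 ≤ l by omega)
    rw [bal, Finset.mem_biUnion]
    exact ⟨_, by simp [h], ih l (by omega)⟩

lemma bal_fun {l : ℕ} {f : ℕ → V} (h : IsW G l f) {j : ℕ} (hj : j ≤ l) :
    f j ∈ bal G l (f 0) ∧ f 0 ∈ bal G l (f j) := by
  obtain ⟨p, hp, -, -⟩ := exists_walk j f (fun i hi => h i (by omega))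
  exact ⟨walk_mem_bal p l (by omega), walk_mem_bal p.reverse l (by simp; omega)⟩

lemma bal_trans {a b : ℕ} {u v w : V} (h1 : v ∈ bal G a u) (h2 : w ∈ bal G b v) :
    w ∈ bal G (a + b) u := by
  induction a generalizing u with
  | zero =>
    simp only [bal, Finset.mem_singleton] at h1
    subst h1; simpa using h2
  | succ a ih =>
    rw [bal, Finset.mem_biUnion] at h1
    obtain ⟨x, hx, hx'⟩ := h1
    rw [show a + 1 + b = (a + b) + 1 by ring, bal, Finset.mem_biUnion]
    exact ⟨x, hx, ih hx'⟩

lemma card_V {K : ℕ} (hK : ∀ v, G.degree v + 1 ≤ K) (hc : G.Connected) :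
    Fintype.card V ≤ K ^ G.diam := by
  obtain ⟨v⟩ := hc.nonempty
  have : (univ : Finset V) ⊆ bal G G.diam v := by
    intro u _
    obtain ⟨p, hp⟩ := hc.exists_walk_length_eq_dist v u
    have := hc.nonempty
    exact walk_mem_bal p _ (hp ▸ SimpleGraph.dist_le_diam
      (SimpleGraph.connected_iff_ediam_ne_top.1 hc))
  exact (Finset.card_le_card this).trans (card_bal hK _ _)

end Graph

end Osajda

namespace Osajda

open Finset

section Single

variable {V C : Type} [Fintype V] [DecidableEq V] [Fintype C] [DecidableEq C]

/-- The bad events for a single graph. -/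
def evSet (G : SimpleGraph V) (k : ℕ) (W : ℕ → Finset (List C)) :
    Set (List (Sym2 V) × List (Sym2 V ⊕ C)) :=
  {p | ∃ (f : ℕ → V) (l : ℕ), 1 ≤ l ∧ IsW G l f ∧ (edgesOf f l).Nodup ∧ p.1 = edgesOf f l ∧
    ((∃ g : ℕ → V, IsW G l g ∧ (edgesOf g l).Nodup ∧ (∀ x ∈ edgesOf g l, x ∉ edgesOf f l) ∧
        (f l = g 0 ∨ g l = f 0 ∨ l = k / 2) ∧ p.2 = (edgesOf g l).map Sum.inl) ∨
      ∃ w ∈ W l, p.2 = w.map Sum.inr)}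

theorem exists_ev_coloring (G : SimpleGraph V) [DecidableRel G.Adj] (K k M0 : ℕ)
    (hK : ∀ v, G.degree v + 1 ≤ K) (hK1 : 1 ≤ K) (hM0 : 1 ≤ M0)
    (hV : Fintype.card V ≤ M0 ^ (k / 2))
    (W : ℕ → Finset (List C)) (hW : ∀ l, 1 ≤ l → (W l).card ≤ M0 ^ l)
    (hC : 4 * (3 * (K ^ 5 * M0)) ≤ Fintype.card C) :
    ∃ c : Sym2 V → C, ∀ p ∈ evSet G k W, p.1.map c ≠ p.2.map (Sum.elim c id) := by
  classical
  let FF : Sym2 V → ℕ → Finset (List (Sym2 V)) := fun e l =>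
    (bal G l (Quot.out e).1).biUnion (EP G l)
  let N1 : Sym2 V → ℕ → Finset (List (Sym2 V ⊕ C)) := fun e l =>
    ((bal G (l + l) (Quot.out e).1).biUnion (EP G l)).image (List.map Sum.inl)
  let N2 : ℕ → Finset (List (Sym2 V ⊕ C)) := fun l =>
    if l = k / 2 then ((univ : Finset V).biUnion (EP G l)).image (List.map Sum.inl) else ∅
  let N3 : ℕ → Finset (List (Sym2 V ⊕ C)) := fun l => (W l).image (List.map Sum.inr)
  refine exists_coloring (evSet G k W) (3 * (K ^ 5 * M0)) (by positivity) hC ?_ ?_ ?_ ?_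
    (fun e l => FF e l ×ˢ (N1 e l ∪ N2 l ∪ N3 l)) ?_ ?_
  · rintro ⟨F, S⟩ ⟨f, l, hl, hf, hnd, rfl, -⟩
    exact hnd
  · rintro ⟨F, S⟩ ⟨f, l, hl, hf, hnd, hF, -⟩ h
    have := length_edgesOf f l
    simp only at hF h
    rw [← hF, h] at this
    simp at this; omega
  · rintro ⟨F, S⟩ ⟨f, l, hl, hf, hnd, hF, ⟨g, hg, hgn, hd, -, hS⟩ | ⟨w, hw, hS⟩⟩ x hx
    · simp only at hF hS hx ⊢
      subst hF hS
      apply hd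
      simpa using hx
    · simp only at hS hx
      subst hS
      simp at hx
  · rintro ⟨F, S⟩ ⟨f, l, hl, hf, hnd, hF, ⟨g, hg, hgn, hd, ho, hS⟩ | ⟨w, hw, hS⟩⟩ x hx
    · simp only at hF hS hx ⊢
      subst hF hS
      refine ⟨_, rfl, g, l, hl, hg, hgn, rfl, Or.inl ⟨f, hf, hnd, fun x hx hx' => hd x hx' hx, ?_, rfl⟩⟩
      tauto
    · simp only at hS hx
      subst hS
      simp at hx
  · rintro ⟨F, S⟩ ⟨f, l, hl, hf, hnd, hF, hS⟩ e he
    simp only at hF hS he ⊢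
    subst hF
    rw [length_edgesOf, Finset.mem_product]
    have hf0 : f 0 ∈ bal G l (Quot.out e).1 := by
      obtain ⟨i, hi, hie⟩ := mem_edgesOf.1 he
      have hm : (Quot.out e).1 ∈ e := Sym2.out_fst_mem e
      rw [← hie, Sym2.mem_iff] at hm
      rw [hie] at hm
      rcases hm with hm | hm
      · rw [hm]; exact (bal_fun hf (by omega)).2
      · rw [hm]; exact (bal_fun hf (by omega)).2
    refine ⟨Finset.mem_biUnion.2 ⟨f 0, hf0, mem_EP l f hf⟩, ?_⟩
    simp only [Finset.mem_union]
    rcases hS with ⟨g, hg, hgn, hd, ho, hS⟩ | ⟨w, hw, hS⟩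
    · left
      subst hS
      have near : g 0 ∈ bal G l (f 0) → List.map Sum.inl (edgesOf g l) ∈ N1 e l := by
        intro h
        exact Finset.mem_image_of_mem _
          (Finset.mem_biUnion.2 ⟨g 0, bal_trans hf0 h, mem_EP l g hg⟩)
      rcases ho with ho | ho | ho
      · left
        apply near
        rw [← ho]; exact (bal_fun hf le_rfl).1
      · left
        apply near
        rw [← ho]; exact (bal_fun hg le_rfl).2
      · right
        simp only [N2, if_pos ho]
        exact Finset.mem_image_of_mem _
          (Finset.mem_biUnion.2 ⟨g 0, Finset.mem_univ _, mem_EP l g hg⟩)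
    · right
      subst hS
      exact Finset.mem_image_of_mem _ hw
  · intro e l hl
    have cFF : (FF e l).card ≤ K ^ l * K ^ l :=
      (Finset.card_biUnion_le_card_mul _ _ (K ^ l) (fun u _ => card_EP hK l u)).trans
        (Nat.mul_le_mul_right _ (card_bal hK _ _))
    have cN1 : (N1 e l).card ≤ K ^ (l + l) * K ^ l :=
      Finset.card_image_le.trans
      ((Finset.card_biUnion_le_card_mul _ _ (K ^ l) (fun u _ => card_EP hK l u)).trans
        (Nat.mul_le_mul_right _ (card_bal hK _ _)))
    have cN2 : (N2 l).card ≤ M0 ^ l * K ^ l := by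
      simp only [N2]
      split_ifs with h
      · refine Finset.card_image_le.trans
          ((Finset.card_biUnion_le_card_mul _ _ (K ^ l) (fun u _ => card_EP hK l u)).trans ?_)
        apply Nat.mul_le_mul_right
        rw [Finset.card_univ, h]; exact hV
      · simp
    have cN3 : (N3 l).card ≤ M0 ^ l := Finset.card_image_le.trans (hW l hl)
    have hk1 : 1 ≤ K ^ l := Nat.one_le_pow _ _ hK1
    have hm1 : 1 ≤ M0 ^ l := Nat.one_le_pow _ _ hM0
    have h3 : 3 ≤ 3 ^ l := by
      calc 3 = 3 ^ 1 := by norm_num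
        _ ≤ 3 ^ l := Nat.pow_le_pow_right (by norm_num) hl
    have b1 : K ^ (l + l) * K ^ l ≤ (K ^ l) ^ 3 * M0 ^ l := by
      calc K ^ (l + l) * K ^ l = (K ^ l) ^ 3 * 1 := by ring
        _ ≤ _ := Nat.mul_le_mul_left _ hm1
    have b2 : M0 ^ l * K ^ l ≤ (K ^ l) ^ 3 * M0 ^ l := by
      rw [mul_comm]
      apply Nat.mul_le_mul_right
      calc K ^ l = (K ^ l) ^ 1 := by ring
        _ ≤ _ := Nat.pow_le_pow_right hk1 (by norm_num)
    have b3 : M0 ^ l ≤ (K ^ l) ^ 3 * M0 ^ l :=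
      Nat.le_mul_of_pos_left _ (by positivity)
    rw [Finset.card_product]
    have hu : (N1 e l ∪ N2 l ∪ N3 l).card ≤ 3 * ((K ^ l) ^ 3 * M0 ^ l) := by
      have := Finset.card_union_le (N1 e l ∪ N2 l) (N3 l)
      have := Finset.card_union_le (N1 e l) (N2 l)
      omega
    calc (FF e l).card * (N1 e l ∪ N2 l ∪ N3 l).card
        ≤ (K ^ l * K ^ l) * (3 * ((K ^ l) ^ 3 * M0 ^ l)) := Nat.mul_le_mul cFF hu
      _ = 3 * ((K ^ l) ^ 5 * M0 ^ l) := by ring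
      _ ≤ 3 ^ l * ((K ^ l) ^ 5 * M0 ^ l) := Nat.mul_le_mul_right _ h3
      _ = (3 * (K ^ 5 * M0)) ^ l := by rw [mul_pow, mul_pow]; ring

/-- The key existence result for a single graph. -/
theorem single (G : SimpleGraph V) [DecidableRel G.Adj] (K k M0 : ℕ)
    (hK : ∀ v, G.degree v + 1 ≤ K) (hK1 : 1 ≤ K) (hM0 : 1 ≤ M0)
    (hk : 2 ≤ k) (hg : 2 * k < G.girth)
    (hV : Fintype.card V ≤ M0 ^ (k / 2))
    (W : ℕ → Finset (List C)) (hW : ∀ l, 1 ≤ l → (W l).card ≤ M0 ^ l)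
    (hC : 4 * (3 * (K ^ 5 * M0)) ≤ Fintype.card C) :
    ∃ c : Sym2 V → C,
      (∀ u v w, G.Adj u v → G.Adj u w → v ≠ w → c s(u, v) ≠ c s(u, w)) ∧
      (∀ f g, IsNBPath G k f → IsNBPath G k g →
        (∀ i < k, c s(f i, f (i + 1)) = c s(g i, g (i + 1))) → ∀ i ≤ k, f i = g i) ∧
      (∀ l, 1 ≤ l → l ≤ k → ∀ f, IsNBPath G l f → (edgesOf f l).map c ∉ W l) := by
  obtain ⟨c, hc⟩ := exists_ev_coloring G K k M0 hK hK1 hM0 hV W hW hC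
  have H : ∀ (f g : ℕ → V) (l : ℕ), 1 ≤ l → IsW G l f → IsW G l g → (edgesOf f l).Nodup →
      (edgesOf g l).Nodup → (∀ x ∈ edgesOf g l, x ∉ edgesOf f l) →
      (f l = g 0 ∨ g l = f 0 ∨ l = k / 2) →
      ¬ ∀ i < l, c s(f i, f (i + 1)) = c s(g i, g (i + 1)) := by
    intro f g l hl hf hg' nf ng hd ho h
    refine hc (edgesOf f l, (edgesOf g l).map Sum.inl)
      ⟨f, l, hl, hf, nf, rfl, Or.inl ⟨g, hg', ng, hd, ho, rfl⟩⟩ ?_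
    simp only [List.map_map]
    have := (map_edgesOf_eq c c f g l).2 h
    rw [this]; rfl
  have proper : ∀ u v w, G.Adj u v → G.Adj u w → v ≠ w → c s(u, v) ≠ c s(u, w) := by
    intro u v w huv huw hvw hcol
    refine H (fun i => if i = 0 then v else u) (fun i => if i = 0 then u else w) 1 le_rfl
      ?_ ?_ ?_ ?_ ?_ (Or.inl (by simp)) ?_
    · intro i hi
      have : i = 0 := by omega
      subst this; simpa using huv.symm
    · intro i hi
      have : i = 0 := by omega
      subst this; simpa using huw
    · simp [edgesOf]
    · simp [edgesOf]
    · have := huv.ne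
      simp [edgesOf]
      grind
    · intro i hi
      have : i = 0 := by omega
      subst this
      simp only [if_true]
      rw [Sym2.eq_swap]
      simpa using hcol
  refine ⟨c, proper, ?_, ?_⟩
  · have sq : ∀ f g, IsNBPath G k f → IsNBPath G k g →
        (∀ i < k, c s(f i, f (i + 1)) = c s(g i, g (i + 1))) →
        ∀ i j, i < j → j < k → f i = g j → f (i + 1) = g (j + 1) → False := by
      intro f g hf hg' hcol i j hij hjk h0 h1
      obtain ⟨s, rfl⟩ := Nat.exists_eq_add_of_lt hij
      have hA : IsNBPath G (s + 1) (fun t => g (i + t)) := IsNBPath_shift hg' (by omega)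
      have hB : IsNBPath G (s + 1) (fun t => f (i + t)) := IsNBPath_shift hf (by omega)
      have e0 : g (i + (s + 1)) = f (i + 0) := by rw [add_zero, h0, add_assoc]
      have hh := glue_nb hA hB e0 (by
        intro _ _
        have h' := hg'.2 (i + s) (by omega)
        rw [h1]
        exact h')
      set h := glue (fun t => g (i + t)) (s + 1) (fun t => f (i + t)) with hdef
      have hl : ∀ t, t ≤ s + 1 → h t = g (i + t) := fun t ht => glue_left _ _ ht
      have hr : ∀ t, h (s + 1 + t) = f (i + t) := fun t => glue_right _ _ e0 t
      have hlt : s + 1 + (s + 1) < G.girth := by omega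
      have inj := nb_inj hh hlt
      have n1 : IsNBPath G (s + 1) h := ⟨fun a ha => hh.1 a (by omega), fun a ha => hh.2 a (by omega)⟩
      have n2 : IsNBPath G (s + 1) (fun t => h (s + 1 + t)) := IsNBPath_shift hh le_rfl
      refine H h (fun t => h (s + 1 + t)) (s + 1) (by omega) n1.1 n2.1
        (nodup_edgesOf n1 (by omega)) (nodup_edgesOf n2 (by omega)) ?_ (Or.inl rfl) ?_
      · intro x hx hx'
        obtain ⟨a, ha, rfl⟩ := mem_edgesOf.1 hx
        obtain ⟨b, hb, hbe⟩ := mem_edgesOf.1 hx'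
        have := edge_inj inj (i := b) (j := s + 1 + a) (by omega) (by omega) hbe
        omega
      · intro a ha
        rw [hl a (by omega), hl (a + 1) (by omega), hr, hr]
        exact (hcol (i + a) (by omega)).symm
    intro f g hf hg' hcol
    have prop : ∀ i, i < k → f i = g i → f (i + 1) = g (i + 1) → ∀ t ≤ k, f t = g t := by
      intro i hi h0 _
      have fwd : ∀ t, i + t ≤ k → f (i + t) = g (i + t) := by
        intro t
        induction t with
        | zero => intro _; exact h0
        | succ t ih =>
          intro ht
          have e := ih (by omega)
          by_contra hne
          have a1 := hf.1 (i + t) (by omega)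
          have a2 := hg'.1 (i + t) (by omega)
          have hc' := hcol (i + t) (by omega)
          rw [← e] at a2 hc'
          exact proper _ _ _ a1 a2 hne hc'
      have bwd : ∀ t, t ≤ i → f (i - t) = g (i - t) := by
        intro t
        induction t with
        | zero => intro _; exact h0
        | succ t ih =>
          intro ht
          have e := ih (by omega)
          by_contra hne
          have hit : i - t = i - (t + 1) + 1 := by omega
          rw [hit] at e
          have a1 := hf.1 (i - (t + 1)) (by omega)
          have a2 := hg'.1 (i - (t + 1)) (by omega)
          have hc' := hcol (i - (t + 1)) (by omega)
          rw [← e] at a2 hc'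
          rw [Sym2.eq_swap, Sym2.eq_swap (a := g _)] at hc'
          exact proper _ _ _ a1.symm a2.symm hne hc'
      intro t ht
      rcases Nat.lt_or_ge t i with h | h
      · have := bwd (i - t) (by omega)
        rwa [show i - (i - t) = t by omega] at this
      · have := fwd (t - i) (by omega)
        rwa [show i + (t - i) = t by omega] at this
    have same : ∀ i j, i < k → j < k → f i = g j → f (i + 1) = g (j + 1) → ∀ t ≤ k, f t = g t := by
      intro i j hi hj h0 h1
      rcases lt_trichotomy i j with h | h | h
      · exact (sq f g hf hg' hcol i j h hj h0 h1).elim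
      · subst h; exact prop i hi h0 h1
      · exact (sq g f hg' hf (fun t ht => (hcol t ht).symm) j i h hi h0.symm h1.symm).elim
    have meet : ∀ a, a + k / 2 ≤ k → ∃ i j, a ≤ i ∧ i < a + k / 2 ∧ a ≤ j ∧ j < a + k / 2 ∧
        s(f i, f (i + 1)) = s(g j, g (j + 1)) := by
      intro a ha
      by_contra hcon
      push Not at hcon
      have n1 : IsNBPath G (k / 2) (fun t => f (a + t)) := IsNBPath_shift hf ha
      have n2 : IsNBPath G (k / 2) (fun t => g (a + t)) := IsNBPath_shift hg' ha
      refine H (fun t => f (a + t)) (fun t => g (a + t)) (k / 2) (by omega) n1.1 n2.1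
        (nodup_edgesOf n1 (by omega)) (nodup_edgesOf n2 (by omega)) ?_ (Or.inr (Or.inr rfl)) ?_
      · intro x hx hx'
        obtain ⟨p, hp, rfl⟩ := mem_edgesOf.1 hx
        obtain ⟨q, hq, hqe⟩ := mem_edgesOf.1 hx'
        exact hcon (a + q) (a + p) (by omega) (by omega) (by omega) (by omega) hqe
      · intro t ht
        exact hcol (a + t) (by omega)
    obtain ⟨i, j, hi0, hi, hj0, hj, he⟩ := meet 0 (by omega)
    obtain ⟨i', j', hi0', hi', hj0', hj', he'⟩ := meet (k / 2) (by omega)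
    rw [Sym2.eq_iff] at he he'
    rcases he with he | he
    · exact same i j (by omega) (by omega) he.1 he.2
    rcases he' with he' | he'
    · exact same i' j' (by omega) (by omega) he'.1 he'.2
    exfalso
    -- closed non-backtracking walk
    have hA : IsNBPath G (i' + 1 - i) (fun t => f (i + t)) := IsNBPath_shift hf (by omega)
    have hB : IsNBPath G (j' - (j + 1)) (fun t => g (j' - t)) := by
      constructor
      · intro t ht
        have := hg'.1 (j' - (t + 1)) (by omega)
        rw [show j' - (t + 1) + 1 = j' - t by omega] at this
        exact this.symm
      · intro t ht
        have := hg'.2 (j' - (t + 2)) (by omega)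
        rw [show j' - (t + 2) + 2 = j' - t by omega] at this
        exact this.symm
    have e0 : f (i + (i' + 1 - i)) = g (j' - 0) := by
      rw [show i + (i' + 1 - i) = i' + 1 by omega]; exact he'.2
    have hh := glue_nb hA hB e0 (by
      intro _ hq
      rw [show i + (i' + 1 - i - 1) = i' by omega, he'.1]
      have := hg'.2 (j' - 1) (by omega)
      rw [show j' - 1 + 2 = j' + 1 by omega] at this
      exact this.symm)
    have := nb_inj hh (by omega) 0 (i' + 1 - i + (j' - (j + 1))) (by omega) le_rfl (by
      rw [glue_right _ _ e0, glue_left _ _ (by omega)]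
      rw [add_zero, show j' - (j' - (j + 1)) = j + 1 by omega]
      exact he.1)
    omega
  · intro l hl hlk f hf hmem
    refine hc (edgesOf f l, ((edgesOf f l).map c).map Sum.inr)
      ⟨f, l, hl, hf.1, nodup_edgesOf hf (by omega), rfl, Or.inr ⟨_, hmem, rfl⟩⟩ ?_
    simp

end Single

end Osajda

namespace Osajda

lemma exists_strong_seq {X : ℕ → Type} (R : ∀ n, (∀ m, m < n → X m) → X n → Prop)
    (h : ∀ n p, ∃ x, R n p x) : ∃ c : ∀ n, X n, ∀ n, R n (fun m _ => c m) (c n) := by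
  choose F hF using h
  let c : ∀ n, X n := WellFounded.fix (C := X) Nat.lt_wfRel.wf (fun n p => F n p)
  refine ⟨c, fun n => ?_⟩
  have : c n = F n (fun m _ => c m) := WellFounded.fix_eq _ _ _
  rw [this]
  exact hF _ _

end Osajda

/-- **Theorem 1: `C'(λ)`-small cancellation labeling of `Θ`.** For a sequence of disjoint
finite connected graphs of degree at most `D ≥ 3`, with girths strictly increasing to
infinity, `diam ≤ A·girth`, and `λ ∈ (0,1/6]` with `λ·girth > 1`, there are a finite
symmetrized label set and a reduced labeling `m = (m_n)` of the sequence over it such that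
no `m_n`-labeling of a path of length at least `λ·girth (Θ n)` in `Θ n` appears as the
`m`-labeling of any other path: neither of a different path in `Θ n`, nor of a path in
`Θ n'` for `n' ≠ n`. -/
theorem statement_6 (D : ℕ) (hD : 3 ≤ D) (A lam : ℝ) (hA : 0 < A)
    (hlam0 : 0 < lam) (hlam6 : lam ≤ 1 / 6)
    (V : ℕ → Type) [∀ n, Fintype (V n)]
    (G : ∀ n, SimpleGraph (V n)) [∀ n, DecidableRel (G n).Adj]
    (hconn : ∀ n, (G n).Connected)
    (hdeg : ∀ n, ∀ v : V n, (G n).degree v ≤ D)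
    (hgrow : Filter.Tendsto (fun n => (G n).girth) Filter.atTop Filter.atTop)
    (hmono : ∀ n, (G n).girth < (G (n + 1)).girth)
    (hdiam : ∀ n, ((G n).diam : ℝ) ≤ A * ((G n).girth : ℝ))
    (hgirth : ∀ n, 1 < lam * ((G n).girth : ℝ)) :
    ∃ (Λ : Type) (_ : Fintype Λ) (bar : Λ → Λ), Function.Involutive bar ∧
      ∃ m : ∀ n, V n → V n → Λ,
        (∀ n, IsLabeling (G n) bar (m n)) ∧
        (∀ n, IsReducedLabeling (G n) (m n)) ∧
        (∀ (n k : ℕ) (f g : ℕ → V n), lam * ((G n).girth : ℝ) ≤ (k : ℝ) →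
          IsNBPath (G n) k f → IsNBPath (G n) k g →
          (∀ i, i < k → m n (f i) (f (i + 1)) = m n (g i) (g (i + 1))) →
          ∀ i, i ≤ k → f i = g i) ∧
        (∀ n n' : ℕ, n ≠ n' → ∀ (k : ℕ) (f : ℕ → V n) (g : ℕ → V n'),
          lam * ((G n).girth : ℝ) ≤ (k : ℝ) →
          IsNBPath (G n) k f → IsNBPath (G n') k g →
          ¬ (∀ i, i < k → m n (f i) (f (i + 1)) = m n' (g i) (g (i + 1)))) := by
  classical
  set K : ℕ := D + 1 with hKdef
  have hK : ∀ n v, (G n).degree v + 1 ≤ K := fun n v => by have := hdeg n v; omega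
  let k : ℕ → ℕ := fun n => ⌈lam * ((G n).girth : ℝ)⌉₊
  have hkge : ∀ n, lam * ((G n).girth : ℝ) ≤ k n := fun n => Nat.le_ceil _
  have hklt : ∀ n, (k n : ℝ) < lam * ((G n).girth : ℝ) + 1 := fun n =>
    Nat.ceil_lt_add_one (by positivity)
  have hk2 : ∀ n, 2 ≤ k n := by
    intro n
    have h1 : (1 : ℝ) < k n := lt_of_lt_of_le (hgirth n) (hkge n)
    have : 1 < k n := by exact_mod_cast h1
    omega
  have hg2 : ∀ n, 2 * k n < (G n).girth := by
    intro n
    have h0 : (0 : ℝ) ≤ (G n).girth := by positivity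
    have h1 : lam * ((G n).girth : ℝ) ≤ 1 / 6 * ((G n).girth : ℝ) :=
      mul_le_mul_of_nonneg_right hlam6 h0
    have h2 := hgirth n
    have h3 := hklt n
    have : (2 * k n : ℝ) < (G n).girth := by linarith
    exact_mod_cast this
  have hgm : StrictMono fun n => (G n).girth := strictMono_nat_of_lt_succ hmono
  have hkm : Monotone k := by
    intro a b hab
    apply Nat.ceil_mono
    apply mul_le_mul_of_nonneg_left _ hlam0.le
    exact_mod_cast hgm.monotone hab
  set a : ℕ := ⌈A / lam⌉₊ with ha
  set b : ℕ := ⌈1 / lam⌉₊ with hb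
  have hdk : ∀ n, (G n).diam ≤ a * k n := by
    intro n
    have h1 : A / lam ≤ a := Nat.le_ceil _
    have h2 : ((G n).diam : ℝ) ≤ a * k n := by
      calc ((G n).diam : ℝ) ≤ A * ((G n).girth : ℝ) := hdiam n
        _ = A / lam * (lam * ((G n).girth : ℝ)) := by field_simp
        _ ≤ a * k n := mul_le_mul h1 (hkge n) (by positivity) (by positivity)
    exact_mod_cast h2
  have hnk : ∀ n, n ≤ b * k n := by
    intro n
    have h1 : 1 / lam ≤ b := Nat.le_ceil _
    have h2 : (n : ℝ) ≤ b * k n := by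
      calc (n : ℝ) ≤ ((G n).girth : ℝ) := by exact_mod_cast hgm.id_le n
        _ = 1 / lam * (lam * ((G n).girth : ℝ)) := by field_simp
        _ ≤ b * k n := mul_le_mul h1 (hkge n) (by positivity) (by positivity)
    exact_mod_cast h2
  have hVc : ∀ n, Fintype.card (V n) ≤ K ^ (a * k n) := fun n =>
    (Osajda.card_V (hK n) (hconn n)).trans (Nat.pow_le_pow_right (by omega) (hdk n))
  set M0 : ℕ := 2 * (b + 1) * K ^ (3 * a + 1) with hM0
  have hM01 : 1 ≤ M0 := by
    have : 0 < M0 := by positivity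
    omega
  have hKM : K ^ (3 * a) ≤ M0 := by
    rw [hM0]
    calc K ^ (3 * a) ≤ K ^ (3 * a + 1) := Nat.pow_le_pow_right (by omega) (by omega)
      _ ≤ _ := Nat.le_mul_of_pos_left _ (by positivity)
  have hVM : ∀ n, Fintype.card (V n) ≤ M0 ^ (k n / 2) := by
    intro n
    calc Fintype.card (V n) ≤ K ^ (a * k n) := hVc n
      _ ≤ K ^ (3 * a * (k n / 2)) := by
          apply Nat.pow_le_pow_right (by omega)
          have h2 := hk2 n
          have : k n ≤ 3 * (k n / 2) := by omega
          calc a * k n ≤ a * (3 * (k n / 2)) := Nat.mul_le_mul_left _ this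
            _ = _ := by ring
      _ = (K ^ (3 * a)) ^ (k n / 2) := by rw [pow_mul]
      _ ≤ _ := Nat.pow_le_pow_left hKM _
  let C : Type := Fin (4 * (3 * (K ^ 5 * M0)))
  let Wd : ∀ n, (∀ m, m < n → (Sym2 (V m) → C)) → ℕ → Finset (List C) := fun n p l =>
    ((Finset.range n).attach.filter (fun m => k m.1 = l)).biUnion fun m =>
      ((Finset.univ : Finset (V m.1)).biUnion (Osajda.EP (G m.1) l)).image
        (List.map (p m.1 (Finset.mem_range.1 m.2)))
  have hWd : ∀ n p l, 1 ≤ l → (Wd n p l).card ≤ M0 ^ l := by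
    intro n p l hl
    have c1 : (Wd n p l).card ≤
        ((Finset.range n).attach.filter (fun m => k m.1 = l)).card * (K ^ (a * l) * K ^ l) := by
      apply Finset.card_biUnion_le_card_mul
      intro m hm
      rw [Finset.mem_filter] at hm
      refine Finset.card_image_le.trans ((Finset.card_biUnion_le_card_mul _ _ (K ^ l)
        (fun u _ => Osajda.card_EP (hK m.1) l u)).trans ?_)
      apply Nat.mul_le_mul_right
      rw [Finset.card_univ, ← hm.2]
      exact hVc m.1
    have c2 : ((Finset.range n).attach.filter (fun m => k m.1 = l)).card ≤ b * l + 1 := by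
      rw [← Finset.card_range (b * l + 1)]
      apply Finset.card_le_card_of_injOn (fun m => m.1)
      · intro m hm
        have hm' := (Finset.mem_filter.1 (Finset.mem_coe.1 hm)).2
        have := hnk m.1
        rw [hm'] at this
        simp only [Finset.coe_range, Set.mem_Iio]
        omega
      · intro x _ y _ h
        exact Subtype.ext h
    have c3 : b * l + 1 ≤ (2 * (b + 1)) ^ l := by
      have h1 : l ≤ 2 ^ l := Nat.lt_two_pow_self.le
      have h2 : b + 1 ≤ (b + 1) ^ l := Nat.le_self_pow (by omega) _
      calc b * l + 1 ≤ l * (b + 1) := by nlinarith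
        _ ≤ 2 ^ l * (b + 1) ^ l := Nat.mul_le_mul h1 h2
        _ = _ := by rw [mul_pow]
    calc (Wd n p l).card ≤ (b * l + 1) * (K ^ (a * l) * K ^ l) :=
          c1.trans (Nat.mul_le_mul_right _ c2)
      _ ≤ (2 * (b + 1)) ^ l * (K ^ (3 * a + 1)) ^ l := by
          apply Nat.mul_le_mul c3
          rw [← pow_add, ← pow_mul]
          apply Nat.pow_le_pow_right (by omega)
          nlinarith [Nat.zero_le (a * l)]
      _ = M0 ^ l := by rw [hM0, mul_pow (2 * (b + 1))]
  obtain ⟨c, hc⟩ := Osajda.exists_strong_seq (X := fun n => Sym2 (V n) → C) (fun n p c =>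
      (∀ u v w, (G n).Adj u v → (G n).Adj u w → v ≠ w → c s(u, v) ≠ c s(u, w)) ∧
      (∀ f g, IsNBPath (G n) (k n) f → IsNBPath (G n) (k n) g →
        (∀ i < k n, c s(f i, f (i + 1)) = c s(g i, g (i + 1))) → ∀ i ≤ k n, f i = g i) ∧
      (∀ l, 1 ≤ l → l ≤ k n → ∀ f, IsNBPath (G n) l f →
        (Osajda.edgesOf f l).map c ∉ Wd n p l))
    (fun n p => Osajda.single (G n) K (k n) M0 (hK n) (by omega) hM01 (hk2 n) (hg2 n) (hVM n)
      (Wd n p) (hWd n p) (by simp [C]))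
  have cross : ∀ n' n : ℕ, n' < n → ∀ (f : ℕ → V n) (g : ℕ → V n'),
      IsNBPath (G n) (k n') f → IsNBPath (G n') (k n') g →
      ¬ ∀ i, i < k n' → c n s(f i, f (i + 1)) = c n' s(g i, g (i + 1)) := by
    intro n' n hlt f g hf hg h
    have h2 := hk2 n'
    refine (hc n).2.2 (k n') (by omega) (hkm hlt.le) f hf ?_
    rw [(Osajda.map_edgesOf_eq (c n) (c n') f g (k n')).2 h]
    simp only [Wd, Finset.mem_biUnion, Finset.mem_filter]
    refine ⟨⟨n', Finset.mem_range.2 hlt⟩, ⟨Finset.mem_attach _ _, rfl⟩, ?_⟩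
    apply Finset.mem_image_of_mem
    exact Finset.mem_biUnion.2 ⟨g 0, Finset.mem_univ _, Osajda.mem_EP _ g hg.1⟩
  have restrict : ∀ (n j k' : ℕ) (f : ℕ → V n), j ≤ k' → IsNBPath (G n) k' f →
      IsNBPath (G n) j f := fun n j k' f hj h =>
    ⟨fun i hi => h.1 i (by omega), fun i hi => h.2 i (by omega)⟩
  let o : ∀ n, V n → ℕ := fun n v => (Fintype.equivFin (V n) v : ℕ)
  have ho : ∀ n u v, o n u = o n v → u = v := fun n u v h =>
    (Fintype.equivFin (V n)).injective (Fin.ext h)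
  refine ⟨C × Bool, inferInstance, fun x => (x.1, !x.2), fun x => by simp,
    fun n u v => (c n s(u, v), decide (o n u < o n v)), ?_, ?_, ?_, ?_⟩
  · intro n u v huv
    have hne : o n u ≠ o n v := fun h => huv.ne (ho n u v h)
    simp only [Prod.mk.injEq]
    refine ⟨by rw [Sym2.eq_swap], ?_⟩
    rw [← decide_not, decide_eq_decide]
    omega
  · intro n u v₁ v₂ h1 h2 hne h
    exact (hc n).1 u v₁ v₂ h1 h2 hne (Prod.mk.inj h).1
  · intro n k' f g hk' hf hg h
    have hkk : k n ≤ k' := Nat.ceil_le.2 hk'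
    have h' : ∀ i, i < k' → c n s(f i, f (i + 1)) = c n s(g i, g (i + 1)) :=
      fun i hi => (Prod.mk.inj (h i hi)).1
    have h0 := (hc n).2.1 f g (restrict n _ _ f hkk hf) (restrict n _ _ g hkk hg)
      (fun i hi => h' i (by omega)) 0 (by omega)
    intro i
    induction i with
    | zero => intro _; exact h0
    | succ t ih =>
      intro ht
      have e := ih (by omega)
      by_contra hne
      have a1 := hf.1 t (by omega)
      have a2 := hg.1 t (by omega)
      have hc' := h' t (by omega)
      rw [← e] at a2 hc'
      exact (hc n).1 _ _ _ a1 a2 hne hc'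
  · intro n n' hnn k' f g hk' hf hg h
    have hkk : k n ≤ k' := Nat.ceil_le.2 hk'
    have h' : ∀ i, i < k' → c n s(f i, f (i + 1)) = c n' s(g i, g (i + 1)) :=
      fun i hi => (Prod.mk.inj (h i hi)).1
    rcases lt_or_gt_of_ne hnn with hlt | hlt
    · exact cross n n' hlt g f (restrict n' _ _ g hkk hg) (restrict n _ _ f hkk hf)
        (fun i hi => (h' i (by omega)).symm)
    · have hm : k n' ≤ k n := hkm hlt.le
      exact cross n' n hlt f g (restrict n _ _ f (by omega) hf) (restrict n' _ _ g (by omega) hg)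
        (fun i hi => h' i (by omega))
end

section
/- Case Ia. Let Θ be a graph with a labeling over a symmetrized alphabet. Let v̄ = (v₀, …, v_k) and w̄ = (w₀, …, w_k) be edge-disjoint paths in Θ such that, for each i = 1, …, k, the oriented edges v_{i−1}v_i and w_{i−1}w_i both carry label a_i. Let ū = (u₀ := v_s, u₁, …, u_r := w_t) (possibly r = 0) be a shortest path in Θ from the vertex set of v̄ to the vertex set of w̄, with s ≥ t. Then the concatenation p := (v₀, …, v_s, u₁, …, u_{r−1}, w_t, w_{t−1}, …, w₀) is a path (without backtracking) of length s + r + t ≤ 2k + r whose labeling word begins with (a₁, a₂, …, a_t) and ends with (ā_t, …, ā₂, ā₁). In particular, if k = ⌊λ·girth(Θ)⌋ with λ·girth(Θ) > 1, r ≤ A·girth(Θ), and t ≥ k/2, then |p| ≤ (2λ + A)·girth(Θ) and t > λ·girth(Θ)/4. -/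
/-- **Case Ia.** Two edge-disjoint paths `v̄ = (v 0, …, v k)` and `w̄ = (w 0, …, w k)` carry
the same labels `a 1, …, a k` (in the same direction), and `ū = (u 0 = v s, …, u r = w t)`
is a shortest path connecting the vertex set of `v̄` with that of `w̄`, with `s ≥ t`. Then
the concatenation `p = (v 0, …, v s, u 1, …, u (r-1), w t, w (t-1), …, w 0)` is a
non-backtracking path of length `s + r + t ≤ 2k + r` whose labeling word begins with
`(a 1, …, a t)` and ends with `(ā t, …, ā 1)`; moreover if `k = ⌊λ·girth⌋` with
`λ·girth > 1`, `r ≤ A·girth` and `t ≥ k/2`, then `|p| ≤ (2λ+A)·girth` and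
`t > λ·girth/4`. -/
theorem statement_7 {V Λ : Type*} (G : SimpleGraph V) (bar : Λ → Λ)
    (hbar : Function.Involutive bar) (ℓ : V → V → Λ) (hℓ : IsLabeling G bar ℓ)
    (A lam : ℝ)
    (k : ℕ) (v w : ℕ → V) (a : ℕ → Λ)
    (hv : IsNBPath G k v) (hw : IsNBPath G k w)
    (hva : ∀ i, i < k → ℓ (v i) (v (i + 1)) = a (i + 1))
    (hwa : ∀ i, i < k → ℓ (w i) (w (i + 1)) = a (i + 1))
    (hdisj : ∀ i, i < k → ∀ j, j < k →
      ¬ ((v i = w j ∧ v (i + 1) = w (j + 1)) ∨ (v i = w (j + 1) ∧ v (i + 1) = w j)))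
    (s t r : ℕ) (hs : s ≤ k) (hts : t ≤ s)
    (u : ℕ → V) (hu0 : u 0 = v s) (hur : u r = w t)
    (huadj : ∀ i, i < r → G.Adj (u i) (u (i + 1)))
    (humin : ∀ (r' : ℕ) (u' : ℕ → V), (∀ i, i < r' → G.Adj (u' i) (u' (i + 1))) →
      (∃ s', s' ≤ k ∧ u' 0 = v s') → (∃ t', t' ≤ k ∧ u' r' = w t') → r ≤ r')
    (p : ℕ → V)
    (hp : ∀ i, p i = if i ≤ s then v i else if i ≤ s + r then u (i - s)
      else w (t + s + r - i)) :
    IsNBPath G (s + r + t) p ∧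
    s + r + t ≤ 2 * k + r ∧
    (∀ m, m < t → ℓ (p m) (p (m + 1)) = a (m + 1)) ∧
    (∀ j, j < t → ℓ (p (s + r + j)) (p (s + r + j + 1)) = bar (a (t - j))) ∧
    (k = ⌊lam * (G.girth : ℝ)⌋₊ → 1 < lam * (G.girth : ℝ) → (r : ℝ) ≤ A * (G.girth : ℝ) →
      (k : ℝ) / 2 ≤ (t : ℝ) →
      ((s + r + t : ℕ) : ℝ) ≤ (2 * lam + A) * (G.girth : ℝ) ∧
      lam * (G.girth : ℝ) / 4 < (t : ℝ)) := by
  have p1 : ∀ i, i ≤ s → p i = v i := fun i hi => by rw [hp, if_pos hi]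
  have p2 : ∀ j, j ≤ r → p (s + j) = u j := by
    intro j hj
    rcases Nat.eq_zero_or_pos j with rfl | h
    · rw [Nat.add_zero, p1 s le_rfl, hu0]
    · rw [hp, if_neg (by omega), if_pos (by omega)]
      congr 1
      omega
  have p3 : ∀ j, j ≤ t → p (s + r + j) = w (t - j) := by
    intro j hj
    rcases Nat.eq_zero_or_pos j with rfl | h
    · rw [Nat.add_zero, p2 r le_rfl, hur, Nat.sub_zero]
    · rw [hp, if_neg (by omega), if_neg (by omega)]
      congr 1
      omega
  have hadjw : ∀ j, j < t → G.Adj (w (t - j - 1)) (w (t - j)) := by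
    intro j hj
    have h := hw.1 (t - j - 1) (by omega)
    rwa [show t - j - 1 + 1 = t - j by omega] at h
  refine ⟨⟨?_, ?_⟩, by omega, ?_, ?_, ?_⟩
  · intro i hi
    rcases lt_or_ge i s with h | h
    · rw [p1 i h.le, p1 (i + 1) h]
      exact hv.1 i (by omega)
    · obtain ⟨j, rfl⟩ := Nat.exists_eq_add_of_le h
      rcases lt_or_ge j r with h' | h'
      · rw [p2 j h'.le, Nat.add_assoc, p2 (j + 1) h']
        exact huadj j h'
      · obtain ⟨m, rfl⟩ := Nat.exists_eq_add_of_le h'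
        rw [← Nat.add_assoc, p3 m (by omega), Nat.add_assoc, p3 (m + 1) (by omega)]
        exact (hadjw m (by omega)).symm
  · intro i hi heq
    rcases lt_or_ge (i + 1) s with h | h
    · rw [p1 i (by omega), p1 (i + 2) (by omega)] at heq
      exact hv.2 i (by omega) heq
    rcases lt_or_ge i s with h0 | h0
    · have his : s = i + 1 := by omega
      rw [p1 i h0.le] at heq
      rcases Nat.eq_zero_or_pos r with hr | hr
      · have h3 := p3 1 (by omega)
        rw [show s + r + 1 = i + 2 by omega] at h3
        rw [h3] at heq
        refine hdisj i (by omega) (t - 1) (by omega) (Or.inl ⟨heq, ?_⟩)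
        rw [show t - 1 + 1 = t by omega, ← hur, hr, hu0, his]
      · have h3 := p2 1 hr
        rw [show s + 1 = i + 2 by omega] at h3
        rw [h3] at heq
        have := humin (r - 1) (fun n => u (n + 1)) (fun n hn => huadj (n + 1) (by omega))
          ⟨i, by omega, heq.symm⟩
          ⟨t, by omega, by rw [show r - 1 + 1 = r by omega, hur]⟩
        omega
    · obtain ⟨j, rfl⟩ := Nat.exists_eq_add_of_le h0
      rcases le_or_gt (j + 2) r with h' | h'
      · rw [p2 j (by omega), Nat.add_assoc, p2 (j + 2) h'] at heq
        have := humin (r - 2) (fun n => if n ≤ j then u n else u (n + 2)) (by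
            intro n hn
            rcases lt_trichotomy n j with hnj | hnj | hnj
            · simp only [if_pos hnj.le, if_pos (show n + 1 ≤ j from hnj)]
              exact huadj n (by omega)
            · subst hnj
              simp only [if_pos le_rfl, if_neg (show ¬ n + 1 ≤ n by omega)]
              rw [heq]
              exact huadj (n + 2) (by omega)
            · simp only [if_neg (show ¬ n ≤ j by omega), if_neg (show ¬ n + 1 ≤ j by omega)]
              exact huadj (n + 2) (by omega))
          ⟨s, hs, by simp [hu0]⟩
          ⟨t, by omega, by
            split_ifs with hc
            · rw [show r - 2 = j by omega, heq, show j + 2 = r by omega, hur]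
            · rw [show r - 2 + 2 = r by omega, hur]⟩
        omega
      · rcases lt_or_ge j r with h2 | h2
        · have h3 := p3 1 (by omega)
          rw [show s + r + 1 = s + j + 2 by omega] at h3
          rw [p2 j h2.le, h3] at heq
          have := humin j u (fun n hn => huadj n (by omega)) ⟨s, hs, hu0⟩
            ⟨t - 1, by omega, heq⟩
          omega
        · obtain ⟨m, rfl⟩ := Nat.exists_eq_add_of_le h2
          rw [← Nat.add_assoc, p3 m (by omega), Nat.add_assoc, p3 (m + 2) (by omega)] at heq
          refine hw.2 (t - (m + 2)) (by omega) ?_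
          rw [← heq]
          congr 1
          omega
  · intro m hm
    rw [p1 m (by omega), p1 (m + 1) (by omega)]
    exact hva m (by omega)
  · intro j hj
    rw [p3 j hj.le, Nat.add_assoc, p3 (j + 1) hj, ← Nat.sub_sub, hℓ _ _ (hadjw j hj)]
    have h := hwa (t - j - 1) (by omega)
    rw [show t - j - 1 + 1 = t - j by omega] at h
    rw [h]
  · intro hk hg hr ht
    have hle : (k : ℝ) ≤ lam * (G.girth : ℝ) := by
      rw [hk]
      exact Nat.floor_le (by linarith)
    have hlt : lam * (G.girth : ℝ) < (k : ℝ) + 1 := by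
      rw [hk]
      exact Nat.lt_floor_add_one _
    have hk1 : (1 : ℝ) ≤ k := by
      have : 0 < k := by
        rw [hk]
        exact Nat.floor_pos.2 hg.le
      exact_mod_cast this
    have hs' : (s : ℝ) ≤ k := by exact_mod_cast hs
    have ht' : (t : ℝ) ≤ k := by exact_mod_cast hts.trans hs
    constructor
    · push_cast
      linarith
    · linarith
end

section
/- Case Ib(i). Let Θ be a graph with a labeling over a symmetrized alphabet. Let v̄ = (v₀, …, v_k) and w̄ = (w₀, …, w_k) be edge-disjoint paths in Θ such that, for each i = 1, …, k, the oriented edge v_{i−1}v_i carries label a_i, and for each i = 0, …, k−1, the oriented edge w_{i+1}w_i carries label a_{k−i}. Let ū = (u₀ := v_s, u₁, …, u_r := w_t) (possibly r = 0) be a shortest path in Θ from the vertex set of v̄ to the vertex set of w̄, with s ≥ t ≥ k/2 and t ≤ 3k/4. Then the concatenation p' := (v₀, …, v_s, u₁, …, u_{r−1}, w_t, w_{t+1}, …, w_k) is a path (without backtracking) of length s + r + (k − t) ≤ 2k + r, whose labeling word begins with (a₁, a₂, …, a_{k−t}) and ends with (ā_{k−t}, …, ā₂, ā₁), where k − t ≥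 k/4. -/
/-- **Case Ib(i).** Edge-disjoint paths `v̄`, `w̄` of length `k`, where `v (i-1) v i`
carries `a i` and `w (i+1) w i` carries `a (k-i)`, joined by a shortest connecting path
`ū = (u 0 = v s, …, u r = w t)` with `k/2 ≤ t ≤ 3k/4` and `t ≤ s`. Then
`p' = (v 0, …, v s, u 1, …, u (r-1), w t, w (t+1), …, w k)` is a non-backtracking path of
length `s + r + (k - t) ≤ 2k + r` whose labeling word begins with `(a 1, …, a (k-t))` and
ends with `(ā (k-t), …, ā 1)`, where `k - t ≥ k/4`. -/
theorem statement_8 {V Λ : Type*} (G : SimpleGraph V) (bar : Λ → Λ)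
    (hbar : Function.Involutive bar) (ℓ : V → V → Λ) (hℓ : IsLabeling G bar ℓ)
    (k : ℕ) (v w : ℕ → V) (a : ℕ → Λ)
    (hv : IsNBPath G k v) (hw : IsNBPath G k w)
    (hva : ∀ i, i < k → ℓ (v i) (v (i + 1)) = a (i + 1))
    (hwa : ∀ i, i < k → ℓ (w (i + 1)) (w i) = a (k - i))
    (hdisj : ∀ i, i < k → ∀ j, j < k →
      ¬ ((v i = w j ∧ v (i + 1) = w (j + 1)) ∨ (v i = w (j + 1) ∧ v (i + 1) = w j)))
    (s t r : ℕ) (hs : s ≤ k) (hts : t ≤ s)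
    (ht2 : (k : ℝ) / 2 ≤ (t : ℝ)) (ht34 : (t : ℝ) ≤ 3 * (k : ℝ) / 4)
    (u : ℕ → V) (hu0 : u 0 = v s) (hur : u r = w t)
    (huadj : ∀ i, i < r → G.Adj (u i) (u (i + 1)))
    (humin : ∀ (r' : ℕ) (u' : ℕ → V), (∀ i, i < r' → G.Adj (u' i) (u' (i + 1))) →
      (∃ s', s' ≤ k ∧ u' 0 = v s') → (∃ t', t' ≤ k ∧ u' r' = w t') → r ≤ r')
    (p : ℕ → V)
    (hp : ∀ i, p i = if i ≤ s then v i else if i ≤ s + r then u (i - s)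
      else w (t + (i - s - r))) :
    IsNBPath G (s + r + (k - t)) p ∧
    s + r + (k - t) ≤ 2 * k + r ∧
    (∀ m, m < k - t → ℓ (p m) (p (m + 1)) = a (m + 1)) ∧
    (∀ j, j < k - t → ℓ (p (s + r + j)) (p (s + r + j + 1)) = bar (a (k - t - j))) ∧
    (k : ℝ) / 4 ≤ ((k - t : ℕ) : ℝ) := by
  have hk4 : k ≤ 4 * (k - t) := by
    have h : (4 * t : ℝ) ≤ 3 * k := by linarith
    have h' : 4 * t ≤ 3 * k := by exact_mod_cast h
    omega
  have hk2 : k ≤ 2 * t := by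
    have h : (k : ℝ) ≤ 2 * t := by linarith
    exact_mod_cast h
  have pv : ∀ i, i ≤ s → p i = v i := by
    intro i hi
    rw [hp, if_pos hi]
  have pu : ∀ j, j ≤ r → p (s + j) = u j := by
    intro j hj
    rcases Nat.eq_zero_or_pos j with h0 | h0
    · subst h0
      rw [hu0]
      exact pv s le_rfl
    · rw [hp, if_neg (by omega), if_pos (by omega)]
      congr 1
      omega
  have pw : ∀ j, p (s + r + j) = w (t + j) := by
    intro j
    rcases Nat.eq_zero_or_pos j with h0 | h0
    · subst h0
      have := pu r le_rfl
      rw [hur] at this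
      exact this
    · rw [hp, if_neg (by omega), if_neg (by omega)]
      congr 1
      omega
  refine ⟨⟨?_, ?_⟩, by omega, ?_, ?_, ?_⟩
  · intro i hi
    by_cases h1 : i < s
    · rw [pv i h1.le, pv (i + 1) h1]
      exact hv.1 i (by omega)
    by_cases h2 : i < s + r
    · obtain ⟨j, rfl⟩ : ∃ j, i = s + j := ⟨i - s, by omega⟩
      rw [add_assoc, pu j (by omega), pu (j + 1) (by omega)]
      exact huadj j (by omega)
    · obtain ⟨j, rfl⟩ : ∃ j, i = s + r + j := ⟨i - (s + r), by omega⟩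
      rw [add_assoc (s + r) j, pw j, pw (j + 1)]
      exact hw.1 (t + j) (by omega)
  · intro i hi
    by_cases h1 : i + 2 ≤ s
    · rw [pv i (by omega), pv (i + 2) h1]
      exact hv.2 i (by omega)
    by_cases h2 : s + r ≤ i
    · obtain ⟨j, rfl⟩ : ∃ j, i = s + r + j := ⟨i - (s + r), by omega⟩
      rw [add_assoc (s + r) j, pw j, pw (j + 2)]
      exact hw.2 (t + j) (by omega)
    by_cases h3 : i < s
    · -- here i + 1 = s
      obtain rfl : s = i + 1 := by omega
      rw [pv i (by omega)]
      intro he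
      rcases Nat.eq_zero_or_pos r with h0 | h0
      · subst h0
        have e := pw 1
        rw [show i + 1 + 0 + 1 = i + 2 by omega] at e
        rw [e] at he
        exact hdisj i (by omega) t (by omega) (Or.inr ⟨he, hu0.symm.trans hur⟩)
      · have e := pu 1 h0
        rw [show i + 1 + 1 = i + 2 by omega] at e
        rw [e] at he
        have := humin (r - 1) (fun j => u (j + 1))
          (fun j hj => huadj (j + 1) (by omega)) ⟨i, by omega, he.symm⟩
          ⟨t, by omega, by
            change u (r - 1 + 1) = w t
            rw [Nat.sub_add_cancel h0, hur]⟩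
        omega
    · obtain ⟨j, rfl⟩ : ∃ j, i = s + j := ⟨i - s, by omega⟩
      rw [pu j (by omega)]
      intro he
      by_cases h4 : j + 2 ≤ r
      · rw [add_assoc, pu (j + 2) h4] at he
        have := humin (r - 2) (fun m => if m ≤ j then u m else u (m + 2))
          (by
            intro m hm
            by_cases h5 : m + 1 ≤ j
            · simp only [if_pos h5, if_pos (show m ≤ j by omega)]
              exact huadj m (by omega)
            · by_cases h6 : m ≤ j
              · obtain rfl : m = j := by omega
                simp only [if_pos le_rfl, if_neg h5]
                rw [he]
                exact huadj (m + 2) (by omega)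
              · simp only [if_neg h6, if_neg h5]
                exact huadj (m + 2) (by omega))
          ⟨s, hs, by simp [hu0]⟩
          ⟨t, by omega, by
            by_cases h7 : r - 2 ≤ j
            · obtain rfl : r = j + 2 := by omega
              simp only [Nat.add_sub_cancel, if_pos le_rfl]
              rw [he, hur]
            · simp only [if_neg h7]
              rw [Nat.sub_add_cancel (by omega), hur]⟩
        omega
      · obtain rfl : r = j + 1 := by omega
        have e := pw 1
        rw [show s + (j + 1) + 1 = s + j + 2 by omega] at e
        rw [e] at he
        have := humin j u (fun m hm => huadj m (by omega)) ⟨s, hs, hu0⟩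
          ⟨t + 1, by omega, he⟩
        omega
  · intro m hm
    rw [pv m (by omega), pv (m + 1) (by omega)]
    exact hva m (by omega)
  · intro j hj
    rw [add_assoc (s + r) j, pw j, pw (j + 1), ← add_assoc, hℓ (w (t + j + 1)) (w (t + j)) (hw.1 (t + j) (by omega)).symm]
    rw [hwa (t + j) (by omega), Nat.sub_sub]
  · have h : (k : ℝ) ≤ 4 * ((k - t : ℕ) : ℝ) := by exact_mod_cast hk4
    linarith
end

section
/- Case Ib(ii). Let Θ be a graph with a labeling over a symmetrized alphabet. Let v̄ = (v₀, …, v_k) and w̄ = (w₀, …, w_k) be edge-disjoint paths in Θ such that, for each i = 1, …, k, the oriented edge v_{i−1}v_i carries label a_i, and for each i = 0, …, k−1, the oriented edge w_{i+1}w_i carries label a_{k−i}. Let ū = (u₀ := v_s, u₁, …, u_r := w_t) (possibly r = 0) be a shortest path in Θ from the vertex set of v̄ to the vertex set of w̄, with s ≥ t > 3k/4. Then the concatenation p'' := (v_{k−t}, …, v_s, u₁, …, u_{r−1}, w_t, w_{t−1}, …, w_{k−s}) is a path (without backtracking) of length 2(s + t − k) + r ≤ 2k + r, whose labeling word both begins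 and ends with the block (a_{k−t+1}, a_{k−t+2}, …, a_s) of length s + t − k > k/4. -/
/-- **Case Ib(ii).** Edge-disjoint paths `v̄`, `w̄` of length `k`, where `v (i-1) v i`
carries `a i` and `w (i+1) w i` carries `a (k-i)`, joined by a shortest connecting path
`ū = (u 0 = v s, …, u r = w t)` with `s ≥ t > 3k/4`. Then
`p'' = (v (k-t), …, v s, u 1, …, u (r-1), w t, w (t-1), …, w (k-s))` is a non-backtracking
path of length `2(s+t-k) + r ≤ 2k + r` whose labeling word both begins and ends with the
block `(a (k-t+1), …, a s)` of length `s + t - k > k/4`. -/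
theorem statement_9 {V Λ : Type*} (G : SimpleGraph V) (bar : Λ → Λ)
    (hbar : Function.Involutive bar) (ℓ : V → V → Λ) (hℓ : IsLabeling G bar ℓ)
    (k : ℕ) (v w : ℕ → V) (a : ℕ → Λ)
    (hv : IsNBPath G k v) (hw : IsNBPath G k w)
    (hva : ∀ i, i < k → ℓ (v i) (v (i + 1)) = a (i + 1))
    (hwa : ∀ i, i < k → ℓ (w (i + 1)) (w i) = a (k - i))
    (hdisj : ∀ i, i < k → ∀ j, j < k →
      ¬ ((v i = w j ∧ v (i + 1) = w (j + 1)) ∨ (v i = w (j + 1) ∧ v (i + 1) = w j)))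
    (s t r : ℕ) (hs : s ≤ k) (hts : t ≤ s)
    (ht34 : 3 * (k : ℝ) / 4 < (t : ℝ))
    (u : ℕ → V) (hu0 : u 0 = v s) (hur : u r = w t)
    (huadj : ∀ i, i < r → G.Adj (u i) (u (i + 1)))
    (humin : ∀ (r' : ℕ) (u' : ℕ → V), (∀ i, i < r' → G.Adj (u' i) (u' (i + 1))) →
      (∃ s', s' ≤ k ∧ u' 0 = v s') → (∃ t', t' ≤ k ∧ u' r' = w t') → r ≤ r')
    (p : ℕ → V)
    (hp : ∀ i, p i = if i ≤ s - (k - t) then v (k - t + i)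
      else if i ≤ s - (k - t) + r then u (i - (s - (k - t)))
      else w (t - (i - (s - (k - t)) - r))) :
    IsNBPath G (2 * (s + t - k) + r) p ∧
    2 * (s + t - k) + r ≤ 2 * k + r ∧
    (∀ m, m < s + t - k → ℓ (p m) (p (m + 1)) = a (k - t + 1 + m)) ∧
    (∀ j, j < s + t - k →
      ℓ (p (s + t - k + r + j)) (p (s + t - k + r + j + 1)) = a (k - t + 1 + j)) ∧
    (k : ℝ) / 4 < ((s + t - k : ℕ) : ℝ) := by
  have ht34' : 3 * k < 4 * t := by
    have h : 3 * (k : ℝ) < 4 * (t : ℝ) := by linarith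
    exact_mod_cast h
  obtain ⟨n, hn⟩ : ∃ n, n = s + t - k := ⟨_, rfl⟩
  have hn' : s - (k - t) = n := by omega
  rw [← hn]
  rw [hn'] at hp
  have hsn : k - t + n = s := by omega
  have hnk : k < 4 * n := by omega
  have P1 : ∀ i, i ≤ n → p i = v (k - t + i) := by
    intro i hi
    rw [hp, if_pos hi]
  have P2 : ∀ i, i ≤ r → p (n + i) = u i := by
    intro i hi
    rcases Nat.eq_zero_or_pos i with rfl | h0
    · rw [P1 _ (by omega), hu0]
      congr 1
    · rw [hp, if_neg (by omega), if_pos (by omega)]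
      congr 1
      omega
  have P3 : ∀ i, p (n + r + i) = w (t - i) := by
    intro i
    rcases Nat.eq_zero_or_pos i with rfl | h0
    · rw [Nat.add_zero, P2 r le_rfl, hur]
      congr 1
    · rw [hp, if_neg (by omega), if_neg (by omega)]
      congr 2
      omega
  -- edges of the last segment
  have W : ∀ j, j < n → w (t - j) = w ((t - (j + 1)) + 1) := by
    intro j hj
    congr 1
    omega
  refine ⟨⟨?_, ?_⟩, by omega, ?_, ?_, ?_⟩
  · intro i hi
    rcases lt_or_ge i n with h1 | h1
    · rw [P1 i h1.le, P1 (i + 1) h1]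
      exact hv.1 (k - t + i) (by omega)
    obtain ⟨j, rfl⟩ := Nat.exists_eq_add_of_le h1
    rcases lt_or_ge j r with h2 | h2
    · rw [P2 j h2.le, Nat.add_assoc, P2 (j + 1) h2]
      exact huadj j h2
    obtain ⟨m, rfl⟩ := Nat.exists_eq_add_of_le h2
    rw [← Nat.add_assoc, P3 m, Nat.add_assoc, P3 (m + 1), W m (by omega)]
    exact (hw.1 _ (by omega)).symm
  · intro i hi
    rcases le_or_gt (i + 2) n with h1 | h1
    · rw [P1 i (by omega), P1 (i + 2) h1]
      exact hv.2 (k - t + i) (by omega)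
    rcases lt_or_ge i n with h2 | h2
    · -- `i + 1 = n`
      obtain rfl : n = i + 1 := by omega
      rw [P1 i (by omega)]
      intro he
      rcases Nat.eq_zero_or_pos r with rfl | hr
      · have h3 := P3 1
        rw [show i + 1 + 0 + 1 = i + 2 by omega] at h3
        rw [h3] at he
        refine hdisj (k - t + i) (by omega) (t - 1) (by omega) (Or.inl ⟨he, ?_⟩)
        rw [show k - t + i + 1 = s by omega, show t - 1 + 1 = t by omega, ← hu0, hur]
      · have h3 := P2 1 hr
        rw [show i + 1 + 1 = i + 2 by omega] at h3
        rw [h3] at he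
        have := humin (r - 1) (fun j => u (j + 1)) (fun j hj => huadj (j + 1) (by omega))
          ⟨k - t + i, by omega, he.symm⟩
          ⟨t, by omega, by
            show u (r - 1 + 1) = w t
            rw [show r - 1 + 1 = r by omega, hur]⟩
        omega
    obtain ⟨j, rfl⟩ := Nat.exists_eq_add_of_le h2
    rcases le_or_gt (j + 2) r with h3 | h3
    · rw [P2 j (by omega), Nat.add_assoc, P2 (j + 2) h3]
      intro he
      have := humin (r - 2) (fun l => if l ≤ j then u l else u (l + 2))
        (by
          intro l hl
          show G.Adj (if l ≤ j then u l else u (l + 2))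
            (if l + 1 ≤ j then u (l + 1) else u (l + 1 + 2))
          by_cases ha : l + 1 ≤ j
          · rw [if_pos (by omega), if_pos ha]
            exact huadj l (by omega)
          · rw [if_neg ha]
            by_cases hb : l ≤ j
            · obtain rfl : l = j := by omega
              rw [if_pos hb, he]
              have := huadj (l + 2) (by omega)
              rwa [show l + 1 + 2 = l + 2 + 1 by omega]
            · rw [if_neg hb]
              have := huadj (l + 2) (by omega)
              rwa [show l + 1 + 2 = l + 2 + 1 by omega])
        ⟨s, hs, by
          show (if 0 ≤ j then u 0 else u (0 + 2)) = v s
          rw [if_pos (Nat.zero_le _), hu0]⟩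
        ⟨t, by omega, by
          show (if r - 2 ≤ j then u (r - 2) else u (r - 2 + 2)) = w t
          rw [← hur]
          split_ifs with hc
          · obtain rfl : r = j + 2 := by omega
            rw [← he]
            congr 1
          · congr 1
            omega⟩
      omega
    rcases lt_or_ge j r with h4 | h4
    · obtain rfl : r = j + 1 := by omega
      have h5 := P3 1
      rw [show n + (j + 1) + 1 = n + j + 2 by omega] at h5
      rw [P2 j (by omega), h5]
      intro he
      have := humin j u (fun l hl => huadj l (by omega)) ⟨s, hs, hu0⟩ ⟨t - 1, by omega, he⟩
      omega
    obtain ⟨m, rfl⟩ := Nat.exists_eq_add_of_le h4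
    rw [← Nat.add_assoc, P3 m, Nat.add_assoc, P3 (m + 2),
      show t - m = t - (m + 2) + 2 by omega]
    exact (hw.2 _ (by omega)).symm
  · intro m hm
    rw [P1 m hm.le, P1 (m + 1) hm, show k - t + 1 + m = k - t + m + 1 by omega]
    exact hva (k - t + m) (by omega)
  · intro j hj
    rw [P3 j, Nat.add_assoc, P3 (j + 1), W j hj, hwa _ (by omega)]
    congr 1
    omega
  · have h : (k : ℝ) < 4 * (n : ℝ) := by exact_mod_cast hnk
    linarith
end

section
/- Case IIa (overlapping paths, same orientation). Let Θ be a graph with a labeling over a symmetrized alphabet. Let v̄ = (v₀, …, v_k) and w̄ = (w₀, …, w_k) be paths in Θ such that, for each i = 1, …, k, the oriented edges v_{i−1}v_i and w_{i−1}w_i both carry label a_i. Suppose v̄ and w̄ overlap exactly along a common subpath: there are r ≥ 1 and s > t with s + r ≤ k, t + r ≤ k such that v_{s+i} = w_{t+i} for i = 0, 1, …, r, and v_a = w_b for no other pair of indices (a, b). Then p := (v_t, v_{t+1}, …, v_s = w_t, w_{t+1}, …, w_s) is a path (without backtracking) of length 2(s − t) ≤ 2k whose labeling word is the block (a_{t+1},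 a_{t+2}, …, a_s) repeated twice. -/
/-- **Case IIa** (overlapping paths, same orientation). Paths `v̄`, `w̄` of length `k` carry
the same labels `a 1, …, a k` in the same direction and overlap exactly along a common
subpath `v (s+i) = w (t+i)`, `i = 0, …, r`, with `r ≥ 1` and `s > t`. Then
`p = (v t, …, v s = w t, w (t+1), …, w s)` is a non-backtracking path of length
`2(s-t) ≤ 2k` whose labeling word is the block `(a (t+1), …, a s)` repeated twice. -/
theorem statement_10 {V Λ : Type*} (G : SimpleGraph V) (bar : Λ → Λ)
    (hbar : Function.Involutive bar) (ℓ : V → V → Λ) (hℓ : IsLabeling G bar ℓ)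
    (k : ℕ) (v w : ℕ → V) (a : ℕ → Λ)
    (hv : IsNBPath G k v) (hw : IsNBPath G k w)
    (hva : ∀ i, i < k → ℓ (v i) (v (i + 1)) = a (i + 1))
    (hwa : ∀ i, i < k → ℓ (w i) (w (i + 1)) = a (i + 1))
    (s t r : ℕ) (hr : 1 ≤ r) (hst : t < s) (hsk : s + r ≤ k) (htk : t + r ≤ k)
    (hover : ∀ i, i ≤ r → v (s + i) = w (t + i))
    (hexact : ∀ a' b' : ℕ, a' ≤ k → b' ≤ k → v a' = w b' →
      ∃ i, i ≤ r ∧ a' = s + i ∧ b' = t + i)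
    (p : ℕ → V)
    (hp : ∀ i, p i = if i ≤ s - t then v (t + i) else w (t + (i - (s - t)))) :
    IsNBPath G (2 * (s - t)) p ∧
    2 * (s - t) ≤ 2 * k ∧
    (∀ m, m < s - t → ℓ (p m) (p (m + 1)) = a (t + 1 + m)) ∧
    (∀ m, m < s - t → ℓ (p (s - t + m)) (p (s - t + m + 1)) = a (t + 1 + m)) := by
  have h1 : ∀ i, i ≤ s - t → p i = v (t + i) := by
    intro i hi
    rw [hp, if_pos hi]
  have h2 : ∀ i, p (s - t + i) = w (t + i) := by
    intro i
    rcases Nat.eq_zero_or_pos i with h | h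
    · subst h
      rw [h1 _ (by omega)]
      have := hover 0 (by omega)
      rw [← this]
      congr 1
      omega
    · rw [hp, if_neg (by omega)]
      congr 1
      omega
  refine ⟨⟨?_, ?_⟩, by omega, ?_, ?_⟩
  · intro i hi
    rcases Nat.lt_or_ge i (s - t) with h | h
    · rw [h1 i (by omega), h1 (i + 1) (by omega)]
      exact hv.1 (t + i) (by omega)
    · obtain ⟨j, rfl⟩ := Nat.exists_eq_add_of_le h
      rw [Nat.add_assoc, h2, h2]
      exact hw.1 (t + j) (by omega)
  · intro i hi
    rcases Nat.lt_or_ge i (s - t) with h | h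
    · rw [h1 i (by omega)]
      have hvv := hv.2 (t + i) (by omega)
      rcases Nat.lt_or_ge (i + 1) (s - t) with h' | h'
      · rw [h1 (i + 2) (by omega)]
        exact hvv
      · have e : i + 2 = s - t + 1 := by omega
        have e' : t + i + 2 = s + 1 := by omega
        rw [e, h2, ← hover 1 hr, ← e']
        exact hvv
    · obtain ⟨j, rfl⟩ := Nat.exists_eq_add_of_le h
      rw [Nat.add_assoc, h2, h2]
      exact hw.2 (t + j) (by omega)
  · intro m hm
    rw [h1 m (by omega), h1 (m + 1) (by omega), Nat.add_right_comm]
    exact hva (t + m) (by omega)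
  · intro m hm
    rw [Nat.add_assoc, h2, h2, Nat.add_right_comm]
    exact hwa (t + m) (by omega)
end

section
/- Case IIb(i). Let Θ be a graph with a labeling over a symmetrized alphabet. Let v̄ = (v₀, …, v_k) and w̄ = (w₀, …, w_k) be paths in Θ such that, for each i = 1, …, k, the oriented edge v_{i−1}v_i carries label a_i, and for each i = 0, …, k−1, the oriented edge w_{i+1}w_i carries label a_{k−i}. Suppose v̄ and w̄ overlap exactly along a common subpath: there are r ≥ 1 and s ≥ t with s + r ≤ k, t + r ≤ k such that v_{s+i} = w_{t+i} for i = 0, 1, …, r, and v_a = w_b for no other pair of indices (a, b). Assume moreover s > k/3 and t < 2k/3. Then p' := (v₀, …, v_s = w_t, w_{t+1}, …, w_k) is a path (without backtracking) of length s + (k − t) ≤ 2k whose labeling word begins with (a₁, a₂, …, a_q) and ends with (ā_q, …, ā₂, ā₁), where q := min(s, k − t) > k/3. -/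
/-- **Case IIb(i).** Paths `v̄`, `w̄` of length `k`, where `v (i-1) v i` carries `a i` and
`w (i+1) w i` carries `a (k-i)`, overlap exactly along a common subpath
`v (s+i) = w (t+i)`, `i = 0, …, r`, with `r ≥ 1` and `s ≥ t`; assume `s > k/3` and
`t < 2k/3`. Then `p' = (v 0, …, v s = w t, w (t+1), …, w k)` is a non-backtracking path of
length `s + (k-t) ≤ 2k` whose labeling word begins with `(a 1, …, a q)` and ends with
`(ā q, …, ā 1)`, where `q = min s (k - t) > k/3`. -/
theorem statement_11 {V Λ : Type*} (G : SimpleGraph V) (bar : Λ → Λ)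
    (hbar : Function.Involutive bar) (ℓ : V → V → Λ) (hℓ : IsLabeling G bar ℓ)
    (k : ℕ) (v w : ℕ → V) (a : ℕ → Λ)
    (hv : IsNBPath G k v) (hw : IsNBPath G k w)
    (hva : ∀ i, i < k → ℓ (v i) (v (i + 1)) = a (i + 1))
    (hwa : ∀ i, i < k → ℓ (w (i + 1)) (w i) = a (k - i))
    (s t r : ℕ) (hr : 1 ≤ r) (hst : t ≤ s) (hsk : s + r ≤ k) (htk : t + r ≤ k)
    (hover : ∀ i, i ≤ r → v (s + i) = w (t + i))
    (hexact : ∀ a' b' : ℕ, a' ≤ k → b' ≤ k → v a' = w b' →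
      ∃ i, i ≤ r ∧ a' = s + i ∧ b' = t + i)
    (hs3 : (k : ℝ) / 3 < (s : ℝ)) (ht3 : (t : ℝ) < 2 * (k : ℝ) / 3)
    (p : ℕ → V)
    (hp : ∀ i, p i = if i ≤ s then v i else w (t + (i - s)))
    (q : ℕ) (hq : q = min s (k - t)) :
    IsNBPath G (s + (k - t)) p ∧
    s + (k - t) ≤ 2 * k ∧
    (k : ℝ) / 3 < (q : ℝ) ∧
    (∀ m, m < q → ℓ (p m) (p (m + 1)) = a (m + 1)) ∧
    (∀ j, j < q →
      ℓ (p (s + (k - t) - q + j)) (p (s + (k - t) - q + j + 1)) = bar (a (q - j))) := by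
  have pv : ∀ i, i ≤ s + 1 → p i = v i := by
    intro i hi
    rw [hp]
    split_ifs with h
    · rfl
    · obtain rfl : i = s + 1 := by omega
      rw [hover 1 hr]
      congr 1
      omega
  have pw : ∀ d, p (s + d) = w (t + d) := by
    intro d
    rw [hp]
    split_ifs with h
    · obtain rfl : d = 0 := by omega
      exact hover 0 (by omega)
    · congr 1
      omega
  have hs : k < 3 * s := by
    have : (k : ℝ) < 3 * s := by linarith
    exact_mod_cast this
  have ht : 3 * t < 2 * k := by
    have : 3 * (t : ℝ) < 2 * k := by linarith
    exact_mod_cast this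
  refine ⟨⟨?_, ?_⟩, by omega, ?_, ?_, ?_⟩
  · intro i hi
    rcases Nat.lt_or_ge i s with h | h
    · rw [pv i (by omega), pv (i + 1) (by omega)]
      exact hv.1 i (by omega)
    · obtain ⟨d, rfl⟩ := Nat.exists_eq_add_of_le h
      rw [pw d, add_assoc, pw (d + 1)]
      exact hw.1 (t + d) (by omega)
  · intro i hi
    rcases Nat.lt_or_ge i s with h | h
    · rw [pv i (by omega), pv (i + 2) (by omega)]
      exact hv.2 i (by omega)
    · obtain ⟨d, rfl⟩ := Nat.exists_eq_add_of_le h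
      rw [pw d, add_assoc, pw (d + 2)]
      exact hw.2 (t + d) (by omega)
  · have h : k < 3 * q := by omega
    have : (k : ℝ) < 3 * q := by exact_mod_cast h
    linarith
  · intro m hm
    rw [pv m (by omega), pv (m + 1) (by omega)]
    exact hva m (by omega)
  · intro j hj
    obtain ⟨d, hd⟩ : ∃ d, s + (k - t) - q + j = s + d :=
      ⟨(k - t) - q + j, by omega⟩
    rw [hd, pw d, add_assoc, pw (d + 1), ← add_assoc,
      hℓ _ _ (hw.1 (t + d) (by omega)).symm, hwa (t + d) (by omega)]
    congr 2
    omega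
end

section
/- Case IIb(ii). Let Θ be a graph with a labeling over a symmetrized alphabet. Let v̄ = (v₀, …, v_k) and w̄ = (w₀, …, w_k) be paths in Θ such that, for each i = 1, …, k, the oriented edge v_{i−1}v_i carries label a_i, and for each i = 0, …, k−1, the oriented edge w_{i+1}w_i carries label a_{k−i}. Suppose v̄ and w̄ overlap exactly along a common subpath: there are r ≥ 1 and s ≥ t with s + r ≤ k, t + r ≤ k such that v_{s+i} = w_{t+i} for i = 0, 1, …, r, and v_a = w_b for no other pair of indices (a, b). Assume moreover t ≥ 2k/3. Then p'' := (v_{k−t}, …, v_s = w_t, w_{t−1}, …, w_{k−s}) is a path (without backtracking) of length 2(s + t − k) ≤ 2k whose labeling word is the block (a_{k−t+1}, a_{k−t+2}, …, a_s) repeated twice, of block length s + t − k ≥ k/3. -/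
/-- **Case IIb(ii).** Paths `v̄`, `w̄` of length `k`, where `v (i-1) v i` carries `a i` and
`w (i+1) w i` carries `a (k-i)`, overlap exactly along a common subpath
`v (s+i) = w (t+i)`, `i = 0, …, r`, with `r ≥ 1` and `s ≥ t`; assume `t ≥ 2k/3`. Then
`p'' = (v (k-t), …, v s = w t, w (t-1), …, w (k-s))` is a non-backtracking path of length
`2(s+t-k) ≤ 2k` whose labeling word is the block `(a (k-t+1), …, a s)` repeated twice, of
block length `s + t - k ≥ k/3`. -/
theorem statement_12 {V Λ : Type*} (G : SimpleGraph V) (bar : Λ → Λ)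
    (hbar : Function.Involutive bar) (ℓ : V → V → Λ) (hℓ : IsLabeling G bar ℓ)
    (k : ℕ) (v w : ℕ → V) (a : ℕ → Λ)
    (hv : IsNBPath G k v) (hw : IsNBPath G k w)
    (hva : ∀ i, i < k → ℓ (v i) (v (i + 1)) = a (i + 1))
    (hwa : ∀ i, i < k → ℓ (w (i + 1)) (w i) = a (k - i))
    (s t r : ℕ) (hr : 1 ≤ r) (hst : t ≤ s) (hsk : s + r ≤ k) (htk : t + r ≤ k)
    (hover : ∀ i, i ≤ r → v (s + i) = w (t + i))
    (hexact : ∀ a' b' : ℕ, a' ≤ k → b' ≤ k → v a' = w b' →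
      ∃ i, i ≤ r ∧ a' = s + i ∧ b' = t + i)
    (ht3 : 2 * (k : ℝ) / 3 ≤ (t : ℝ))
    (p : ℕ → V)
    (hp : ∀ i, p i = if i ≤ s - (k - t) then v (k - t + i)
      else w (t - (i - (s - (k - t))))) :
    IsNBPath G (2 * (s + t - k)) p ∧
    2 * (s + t - k) ≤ 2 * k ∧
    (k : ℝ) / 3 ≤ ((s + t - k : ℕ) : ℝ) ∧
    (∀ m, m < s + t - k → ℓ (p m) (p (m + 1)) = a (k - t + 1 + m)) ∧
    (∀ m, m < s + t - k →
      ℓ (p (s + t - k + m)) (p (s + t - k + m + 1)) = a (k - t + 1 + m)) := by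
  have h3 : 2 * k ≤ 3 * t := by
    have : (2 * k : ℝ) ≤ 3 * t := by linarith
    exact_mod_cast this
  obtain ⟨n, hn⟩ : ∃ n, n = s + t - k := ⟨_, rfl⟩
  have hn' : s - (k - t) = n := by omega
  have hnk : n + k = s + t := by omega
  rw [← hn]
  rw [hn'] at hp
  have p1 : ∀ i j, i ≤ n → j = k - t + i → p i = v j := by
    intro i j hi hj
    rw [hp, if_pos hi, hj]
  have p2 : ∀ i j, n ≤ i → i ≤ 2 * n → j + i = t + n → p i = w j := by
    intro i j hi hi2 hj
    rcases Nat.eq_or_lt_of_le hi with h | h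
    · have h0 := hover 0 (Nat.zero_le _)
      rw [p1 i s (by omega) (by omega)]
      have : j = t := by omega
      rw [this]
      exact h0
    · rw [hp, if_neg (by omega)]
      congr 1
      omega
  refine ⟨⟨?_, ?_⟩, by omega, ?_, ?_, ?_⟩
  · intro i hi
    by_cases h : i < n
    · rw [p1 i (k - t + i) (by omega) rfl, p1 (i + 1) (k - t + i + 1) (by omega) (by omega)]
      exact hv.1 _ (by omega)
    · rw [p2 i (t + n - (i + 1) + 1) (by omega) (by omega) (by omega),
        p2 (i + 1) (t + n - (i + 1)) (by omega) (by omega) (by omega)]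
      exact (hw.1 _ (by omega)).symm
  · intro i hi
    rcases lt_trichotomy (i + 1) n with h | h | h
    · rw [p1 i (k - t + i) (by omega) rfl, p1 (i + 2) (k - t + i + 2) (by omega) (by omega)]
      exact hv.2 _ (by omega)
    · rw [p1 i (k - t + i) (by omega) rfl, p2 (i + 2) (t - 1) (by omega) (by omega) (by omega)]
      intro he
      obtain ⟨j, hj, h1, h2⟩ := hexact _ _ (by omega) (by omega) he
      omega
    · rw [p2 i (t + n - (i + 2) + 2) (by omega) (by omega) (by omega),
        p2 (i + 2) (t + n - (i + 2)) (by omega) (by omega) (by omega)]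
      exact (hw.2 _ (by omega)).symm
  · have h4 : k ≤ 3 * n := by omega
    have : (k : ℝ) ≤ 3 * n := by exact_mod_cast h4
    linarith
  · intro m hm
    rw [p1 m (k - t + m) (by omega) rfl, p1 (m + 1) (k - t + m + 1) (by omega) (by omega),
      hva _ (by omega)]
    congr 1
    omega
  · intro m hm
    rw [p2 (n + m) (t - m - 1 + 1) (by omega) (by omega) (by omega),
      p2 (n + m + 1) (t - m - 1) (by omega) (by omega) (by omega), hwa _ (by omega)]
    congr 1
    omega
end

section
/- Case IIb(iii). Let Θ be a graph with a labeling over a symmetrized alphabet. Let v̄ = (v₀, …, v_k) and w̄ = (w₀, …, w_k) be paths in Θ such that, for each i = 1, …, k, the oriented edge v_{i−1}v_i carries label a_i, and for each i = 0, …, k−1, the oriented edge w_{i+1}w_i carries label a_{k−i}. Suppose v̄ and w̄ overlap exactly along a common subpath: there are r ≥ 1 and s ≥ t with s + r ≤ k, t + r ≤ k such that v_{s+i} = w_{t+i} for i = 0, 1, …, r, and v_a = w_b for no other pair of indices (a, b). Assume moreover s ≤ k/3 and s + r ≥ 2k/3. Then p' := (v₀, …, v_s = w_t, w_{t+1}, …,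 w_k) is a path (without backtracking) of length s + (k − t) ≤ 2k whose labeling word x₁⋯x_n (n = s + k − t) satisfies: for q := min(s + r, k − t) ≥ k/3, one has x_{n−q+m} = x̄_{q−m+1} for m = 1, …, q (the suffix of length q is the reversed word of the inverses of the prefix of length q). -/
/-- **Case IIb(iii).** Paths `v̄`, `w̄` of length `k`, where `v (i-1) v i` carries `a i` and
`w (i+1) w i` carries `a (k-i)`, overlap exactly along a common subpath
`v (s+i) = w (t+i)`, `i = 0, …, r`, with `r ≥ 1` and `s ≥ t`; assume `s ≤ k/3` and
`s + r ≥ 2k/3`. Then `p' = (v 0, …, v s = w t, w (t+1), …, w k)` is a non-backtracking path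
of length `n = s + (k-t) ≤ 2k` whose labeling word `x`, with `q = min (s+r) (k-t) ≥ k/3`,
satisfies `x (n-q+m) = bar (x (q-1-m))` for `m = 0, …, q-1`: its suffix of length `q` is the
reversed word of the inverses of its prefix of length `q`. -/
theorem statement_13 {V Λ : Type*} (G : SimpleGraph V) (bar : Λ → Λ)
    (hbar : Function.Involutive bar) (ℓ : V → V → Λ) (hℓ : IsLabeling G bar ℓ)
    (k : ℕ) (v w : ℕ → V) (a : ℕ → Λ)
    (hv : IsNBPath G k v) (hw : IsNBPath G k w)
    (hva : ∀ i, i < k → ℓ (v i) (v (i + 1)) = a (i + 1))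
    (hwa : ∀ i, i < k → ℓ (w (i + 1)) (w i) = a (k - i))
    (s t r : ℕ) (hr : 1 ≤ r) (hst : t ≤ s) (hsk : s + r ≤ k) (htk : t + r ≤ k)
    (hover : ∀ i, i ≤ r → v (s + i) = w (t + i))
    (hexact : ∀ a' b' : ℕ, a' ≤ k → b' ≤ k → v a' = w b' →
      ∃ i, i ≤ r ∧ a' = s + i ∧ b' = t + i)
    (hs3 : (s : ℝ) ≤ (k : ℝ) / 3) (hsr3 : 2 * (k : ℝ) / 3 ≤ ((s + r : ℕ) : ℝ))
    (p : ℕ → V)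
    (hp : ∀ i, p i = if i ≤ s then v i else w (t + (i - s)))
    (n q : ℕ) (hn : n = s + (k - t)) (hq : q = min (s + r) (k - t)) :
    IsNBPath G n p ∧
    n ≤ 2 * k ∧
    (k : ℝ) / 3 ≤ (q : ℝ) ∧
    (∀ m, m < q →
      ℓ (p (n - q + m)) (p (n - q + m + 1)) =
        bar (ℓ (p (q - 1 - m)) (p (q - 1 - m + 1)))) := by
  have hpv : ∀ i, i ≤ s + r → p i = v i := by
    intro i hi
    rw [hp]
    split_ifs with h
    · rfl
    · rw [← hover (i - s) (by omega)]
      congr 1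
      omega
  have hpw : ∀ j, t ≤ j → p (s + (j - t)) = w j := by
    intro j hj
    rcases Nat.eq_or_lt_of_le hj with h | h
    · subst h
      have h0 := hover 0 (by omega)
      simp only [Nat.add_zero] at h0
      rw [Nat.sub_self, Nat.add_zero, hpv s (by omega), h0]
    · rw [hp, if_neg (by omega)]
      congr 1
      omega
  have hs3' : 3 * s ≤ k := by
    have : (3 * s : ℝ) ≤ k := by linarith
    exact_mod_cast this
  have hsr3' : 2 * k ≤ 3 * (s + r) := by
    have : (2 * k : ℝ) ≤ 3 * ((s + r : ℕ) : ℝ) := by linarith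
    exact_mod_cast this
  have hq1 : q ≤ s + r := by omega
  have hq2 : q ≤ k - t := by omega
  refine ⟨⟨?_, ?_⟩, by omega, ?_, ?_⟩
  · intro i hi
    by_cases h : i < s
    · rw [hpv i (by omega), hpv (i + 1) (by omega)]
      exact hv.1 i (by omega)
    · have h1 := hpw (t + (i - s)) (by omega)
      have h2 := hpw (t + (i - s) + 1) (by omega)
      rw [show s + (t + (i - s) - t) = i by omega] at h1
      rw [show s + (t + (i - s) + 1 - t) = i + 1 by omega] at h2
      rw [h1, h2]
      exact hw.1 _ (by omega)
  · intro i hi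
    by_cases h : i < s
    · rw [hpv i (by omega), hpv (i + 2) (by omega)]
      exact hv.2 i (by omega)
    · have h1 := hpw (t + (i - s)) (by omega)
      have h2 := hpw (t + (i - s) + 2) (by omega)
      rw [show s + (t + (i - s) - t) = i by omega] at h1
      rw [show s + (t + (i - s) + 2 - t) = i + 2 by omega] at h2
      rw [h1, h2]
      exact hw.2 _ (by omega)
  · have h : k ≤ 3 * q := by omega
    have h' : (k : ℝ) ≤ 3 * q := by exact_mod_cast h
    linarith
  · intro m hm
    have h1 := hpw (k - q + m) (by omega)
    have h2 := hpw (k - q + m + 1) (by omega)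
    rw [show s + (k - q + m - t) = n - q + m by omega] at h1
    rw [show s + (k - q + m + 1 - t) = n - q + m + 1 by omega] at h2
    rw [h1, h2, hpv (q - 1 - m) (by omega), hpv (q - 1 - m + 1) (by omega),
      hva _ (by omega), hℓ _ _ (hw.1 (k - q + m) (by omega)).symm, hwa _ (by omega)]
    congr 2
    omega
end
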